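/- Let p > 1, f(u) = (1+u)^p, and Ω an arbitrary bounded smooth domain in ℝⁿ. If (u_m) is a sequence of semistable solutions of (N_{λ_m}) satisfying the stability inequality, then sup_m ‖u_m‖_{L^∞(Ω)} < ∞ whenever n < (4(p+1)/(p−1))·α* + 2, where α* is the largest real root of the polynomial (p+1)²α⁴ − 8p(p+1)α² + 4p(p+3)α − 4p. -/

import Mathlib

open MeasureTheory Filter Topology Real Set

noncomputable section

/-- The Laplacian of a real-valued function on Euclidean space. -/
def lap {n : ℕ} (u : EuclideanSpace ℝ (Fin n) → ℝ) (x : EuclideanSpace ℝ (Fin n)) : ℝ :=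
  ∑ i : Fin n, iteratedFDeriv ℝ 2 u x ![EuclideanSpace.single i (1:ℝ), EuclideanSpace.single i (1:ℝ)]

/-- A bounded (smooth) domain. -/
def GoodDomain {n : ℕ} (Ω : Set (EuclideanSpace ℝ (Fin n))) : Prop :=
  IsOpen Ω ∧ Bornology.IsBounded Ω ∧ Ω.Nonempty

/-- The domain `[0, a_f)` of the nonlinearity. -/
def domf (a : EReal) : Set ℝ := {t : ℝ | 0 ≤ t ∧ (t : EReal) < a}

/-- The filter of `t → a_f⁻`. -/
def afFilter (a : EReal) : Filter ℝ :=
  if a = ⊤ then Filter.atTop else nhdsWithin a.toReal (Set.Iio a.toReal)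

/-- Hypothesis (H) on the nonlinearity `f : [0, a_f) → ℝ₊`. -/
structure HypH (a : EReal) (f : ℝ → ℝ) : Prop where
  a_pos : 0 < a
  smooth : ContDiffOn ℝ (⊤ : ℕ∞) f (domf a)
  mono : StrictMonoOn f (domf a)
  convex : ConvexOn ℝ (domf a) f
  f0_pos : 0 < f 0
  pos : ∀ t ∈ domf a, 0 < f t
  blowup : Filter.Tendsto f (afFilter a) Filter.atTop
  superlinear : a = ⊤ → Filter.Tendsto (fun t => f t / t) Filter.atTop Filter.atTop

/-- `τ₋ = liminf_{t → a_f} f f'' / (f')²`. -/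
def tauMinus (a : EReal) (f : ℝ → ℝ) : ℝ :=
  Filter.liminf (fun t => f t * deriv (deriv f) t / (deriv f t) ^ 2) (afFilter a)

/-- `τ₊ = limsup_{t → a_f} f f'' / (f')²`. -/
def tauPlus (a : EReal) (f : ℝ → ℝ) : ℝ :=
  Filter.limsup (fun t => f t * deriv (deriv f) t / (deriv f t) ^ 2) (afFilter a)

/-- `u` is a (smooth, `[0,a_f)`-valued) solution of `Δ²u = λ f(u)` in `Ω`,
`u = Δu = 0` on `∂Ω`. -/
def Solves {n : ℕ} (Ω : Set (EuclideanSpace ℝ (Fin n))) (a : EReal) (lam : ℝ)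
    (f : ℝ → ℝ) (u : EuclideanSpace ℝ (Fin n) → ℝ) : Prop :=
  ContDiff ℝ (⊤ : ℕ∞) u ∧ (∀ x ∈ Ω, 0 ≤ u x ∧ (u x : EReal) < a) ∧
  (∀ x ∈ Ω, lap (lap u) x = lam * f (u x)) ∧
  (∀ x ∈ frontier Ω, u x = 0) ∧ (∀ x ∈ frontier Ω, lap u x = 0)

/-- `u` is a semistable solution: the second variation is nonnegative over
test functions in `H² ∩ H¹₀` (modelled by smooth functions vanishing on `∂Ω`). -/
def Semistable {n : ℕ} (Ω : Set (EuclideanSpace ℝ (Fin n))) (lam : ℝ)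
    (f : ℝ → ℝ) (u : EuclideanSpace ℝ (Fin n) → ℝ) : Prop :=
  ∀ φ : EuclideanSpace ℝ (Fin n) → ℝ, ContDiff ℝ (⊤ : ℕ∞) φ → (∀ x ∈ frontier Ω, φ x = 0) →
    0 ≤ ∫ x in Ω, ((lap φ x) ^ 2 - lam * deriv f (u x) * (φ x) ^ 2)

/-- `u` satisfies the stability inequality
`√λ ∫ √(f'(u)) φ² ≤ ∫ |∇φ|²` for all `φ ∈ H¹₀(Ω)`
(modelled by smooth compactly supported test functions). -/
def StabIneq {n : ℕ} (Ω : Set (EuclideanSpace ℝ (Fin n))) (lam : ℝ)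
    (f : ℝ → ℝ) (u : EuclideanSpace ℝ (Fin n) → ℝ) : Prop :=
  ∀ φ : EuclideanSpace ℝ (Fin n) → ℝ, ContDiff ℝ (⊤ : ℕ∞) φ → HasCompactSupport φ →
    tsupport φ ⊆ Ω →
    Real.sqrt lam * ∫ x in Ω, Real.sqrt (deriv f (u x)) * (φ x) ^ 2 ≤
      ∫ x in Ω, ‖gradient φ x‖ ^ 2

/-- The quartic polynomial `P_f(α, τ₋, τ₊)`. -/
def Pf (τm τp α : ℝ) : ℝ :=
  (2 - τm) ^ 2 * α ^ 4 - 8 * (2 - τp) * α ^ 2 + 4 * (4 - 3 * τp) * α - 4 * (1 - τp)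

/-- `F(t) = ∫₀ᵗ f(s) ds`. -/
def Fint (f : ℝ → ℝ) (t : ℝ) : ℝ := ∫ s in (0:ℝ)..t, f s

/-- `f̃(t) = f(t) - f(0)`. -/
def ftil (f : ℝ → ℝ) (t : ℝ) : ℝ := f t - f 0

/-- `Θ(t) = ∫₀ᵗ θ'(s)² ds`. -/
def Theta (θ : ℝ → ℝ) (t : ℝ) : ℝ := ∫ s in (0:ℝ)..t, (deriv θ s) ^ 2


structure TestPair (G K : ℝ → ℝ) (ε : ℝ) : Prop where
  eps_pos : 0 < ε
  smooth : ContDiff ℝ (⊤ : ℕ∞) G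
  hK : ∀ τ, HasDerivAt K ((deriv G τ) ^ 2) τ
  G0 : ∀ τ ≤ ε, G τ = 0
  K0 : ∀ τ ≤ ε, K τ = 0

lemma deriv_cont_of_smooth {G : ℝ → ℝ} (hG : ContDiff ℝ (⊤ : ℕ∞) G) :
    Continuous (deriv G) :=
  hG.continuous_deriv (by exact_mod_cast le_top)

lemma primK_hasDeriv {G : ℝ → ℝ} (hG : ContDiff ℝ (⊤ : ℕ∞) G) (c τ : ℝ) :
    HasDerivAt (fun τ => ∫ s in c..τ, (deriv G s) ^ 2) ((deriv G τ) ^ 2) τ := by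
  have hc : Continuous (fun s => (deriv G s) ^ 2) := (deriv_cont_of_smooth hG).pow 2
  exact intervalIntegral.integral_hasDerivAt_right (hc.intervalIntegrable _ _)
    (hc.stronglyMeasurableAtFilter _ _) hc.continuousAt

lemma primK_mono {G : ℝ → ℝ} (hG : ContDiff ℝ (⊤ : ℕ∞) G) (c : ℝ) :
    Monotone (fun τ => ∫ s in c..τ, (deriv G s) ^ 2) := by
  apply monotone_of_deriv_nonneg
  · intro τ; exact (primK_hasDeriv hG c τ).differentiableAt
  · intro τ; rw [(primK_hasDeriv hG c τ).deriv]; positivity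

lemma primK_zero {G : ℝ → ℝ} (c : ℝ) (hG0 : ∀ τ, 0 ≤ G τ)
    (hz : ∀ τ ≤ c, G τ = 0) {τ : ℝ} (hτ : τ ≤ c) : ∫ s in c..τ, (deriv G s) ^ 2 = 0 := by
  rw [intervalIntegral.integral_congr (g := fun _ => (0:ℝ))]
  · simp
  · intro s hs
    rw [uIcc_of_ge hτ] at hs
    have : IsLocalMin G s := by
      refine Eventually.of_forall fun y => ?_
      rw [hz s hs.2]; exact hG0 y
    simp [this.deriv_eq_zero]

lemma stamp_pair : ∃ M : ℝ, 0 < M ∧ ∀ a h : ℝ, 0 < a → a < h → ∃ (G K : ℝ → ℝ) (ε : ℝ),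
    TestPair G K ε ∧ (∀ τ, 0 ≤ G τ) ∧ (∀ τ, h ≤ τ → G τ = 1) ∧
    (∀ τ, 0 ≤ K τ) ∧ (∀ τ, K τ ≤ M / (h - a)) ∧ (∀ τ ≤ a, K τ = 0) := by
  set S := Real.smoothTransition with hS
  have hSs : ContDiff ℝ (⊤ : ℕ∞) S := Real.smoothTransition.contDiff
  set L : ℝ → ℝ := fun τ => ∫ s in (0:ℝ)..τ, (deriv S s) ^ 2 with hL
  have hLm : Monotone L := primK_mono hSs 0
  have hL0 : ∀ τ ≤ 0, L τ = 0 := fun τ hτ =>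
    primK_zero 0 Real.smoothTransition.nonneg (fun τ hτ => Real.smoothTransition.zero_of_nonpos hτ) hτ
  have hL1 : ∀ τ, 1 ≤ τ → L τ = L 1 := by
    intro τ hτ
    have hc : Continuous (fun s => (deriv S s) ^ 2) := (deriv_cont_of_smooth hSs).pow 2
    have h1 : L 1 + ∫ s in (1:ℝ)..τ, (deriv S s) ^ 2 = L τ :=
      intervalIntegral.integral_add_adjacent_intervals (hc.intervalIntegrable _ _)
        (hc.intervalIntegrable _ _)
    rw [← h1, intervalIntegral.integral_congr (g := fun _ => (0:ℝ))]
    · simp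
    · intro s hs
      rw [uIcc_of_le hτ] at hs
      have : IsLocalMax S s := by
        refine Eventually.of_forall fun y => ?_
        rw [hS, Real.smoothTransition.one_of_one_le hs.1]; exact Real.smoothTransition.le_one y
      simp [this.deriv_eq_zero]
  have hLn : ∀ τ, 0 ≤ L τ := by
    intro τ
    rcases le_total τ 0 with h | h
    · rw [hL0 τ h]
    · rw [← hL0 0 le_rfl]; exact hLm h
  have hLb : ∀ τ, L τ ≤ L 1 := by
    intro τ
    rcases le_total τ 1 with h | h
    · exact hLm h
    · exact (hL1 τ h).le
  refine ⟨L 1 + 1, by linarith [hLn 1], fun a h ha hah => ?_⟩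
  have hd : 0 < h - a := by linarith
  refine ⟨fun τ => S ((τ - a) / (h - a)), fun τ => (1 / (h - a)) * L ((τ - a) / (h - a)), a,
    ⟨ha, ?_, ?_, ?_, ?_⟩, ?_, ?_, ?_, ?_, ?_⟩
  · exact hSs.comp ((contDiff_id.sub contDiff_const).div_const _)
  · intro τ
    have h1 : HasDerivAt (fun τ : ℝ => (τ - a) / (h - a)) (1 / (h - a)) τ :=
      ((hasDerivAt_id τ).sub_const a).div_const _
    have h2 := ((hSs.differentiable (by simp)) ((τ - a) / (h - a))).hasDerivAt.comp τ h1
    have h3 := ((primK_hasDeriv hSs 0 ((τ - a) / (h - a))).comp τ h1).const_mul (1 / (h - a))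
    have h2' : deriv (fun τ => S ((τ - a) / (h - a))) τ = _ := h2.deriv
    rw [h2']
    refine HasDerivAt.congr_deriv h3 ?_
    ring
  · intro τ hτ
    exact Real.smoothTransition.zero_of_nonpos (div_nonpos_of_nonpos_of_nonneg (by linarith) hd.le)
  · intro τ hτ
    rw [hL0 _ (div_nonpos_of_nonpos_of_nonneg (by linarith) hd.le), mul_zero]
  · intro τ; exact Real.smoothTransition.nonneg _
  · intro τ hτ
    exact Real.smoothTransition.one_of_one_le (by rw [le_div_iff₀ hd]; linarith)
  · intro τ; have := hLn ((τ - a) / (h - a)); positivity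
  · intro τ
    simp only
    rw [div_mul_eq_mul_div, one_mul]
    gcongr
    linarith [hLb ((τ - a) / (h - a))]
  · intro τ hτ
    simp only
    rw [hL0 _ (div_nonpos_of_nonpos_of_nonneg (by linarith) hd.le), mul_zero]

lemma power_pair (t : ℝ) (ht : 1 / 2 < t) (δ : ℝ) (hδ : 0 < δ) : ∃ (G K : ℝ → ℝ) (ε : ℝ),
    TestPair G K ε ∧ (∀ τ, 0 ≤ G τ) ∧ (∀ τ, 0 ≤ τ → τ ≤ δ ∨ G τ = τ ^ t) ∧
    (∀ τ, 0 ≤ K τ) ∧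
    (∀ τ, 0 ≤ τ → K τ ≤ t ^ 2 / (2 * t - 1) * τ ^ (2 * t - 1) + δ) := by
  set S := Real.smoothTransition with hS
  have hSs : ContDiff ℝ (⊤ : ℕ∞) S := Real.smoothTransition.contDiff
  set G : ℝ → ℝ := fun σ => σ ^ t * S (σ - 1) with hG
  have hGz : ∀ σ ≤ 1, G σ = 0 := by
    intro σ hσ
    simp only [hG]
    rw [hS, Real.smoothTransition.zero_of_nonpos (by linarith), mul_zero]
  have hGn : ∀ σ, 0 ≤ G σ := by
    intro σ
    rcases le_total σ 1 with h | h
    · rw [hGz σ h]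
    · exact mul_nonneg (Real.rpow_nonneg (by linarith) _) (Real.smoothTransition.nonneg _)
  have hG2 : ∀ σ, 2 ≤ σ → G σ = σ ^ t := by
    intro σ hσ
    simp only [hG]
    rw [hS, Real.smoothTransition.one_of_one_le (by linarith), mul_one]
  have hGs : ContDiff ℝ (⊤ : ℕ∞) G := by
    rw [contDiff_iff_contDiffAt]
    intro σ
    rcases lt_or_ge σ 1 with h | h
    · have : G =ᶠ[𝓝 σ] fun _ => 0 := by
        filter_upwards [Iio_mem_nhds h] with y hy
        exact hGz y (le_of_lt hy)
      exact contDiffAt_const.congr_of_eventuallyEq this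
    · refine ContDiffAt.mul ?_ ?_
      · exact Real.contDiffAt_rpow_const_of_ne (by linarith)
      · exact (hSs.comp (contDiff_id.sub contDiff_const)).contDiffAt
  set L : ℝ → ℝ := fun τ => ∫ s in (1:ℝ)..τ, (deriv G s) ^ 2 with hL
  have hLm : Monotone L := primK_mono hGs 1
  have hL0 : ∀ τ ≤ 1, L τ = 0 := fun τ hτ => primK_zero 1 hGn hGz hτ
  have hLn : ∀ τ, 0 ≤ L τ := by
    intro τ
    rcases le_total τ 1 with h | h
    · rw [hL0 τ h]
    · rw [← hL0 1 le_rfl]; exact hLm h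
  have h2t : 0 < 2 * t - 1 := by linarith
  set c := t ^ 2 / (2 * t - 1) with hc
  have hcpos : 0 < c := by positivity
  have hLb : ∀ σ, 0 ≤ σ → L σ ≤ c * σ ^ (2 * t - 1) + L 2 := by
    intro σ hσ
    rcases le_total σ 2 with h | h
    · have := hLm h
      have h2 : 0 ≤ c * σ ^ (2 * t - 1) := by positivity
      linarith
    · have hcont : Continuous (fun s => (deriv G s) ^ 2) := (deriv_cont_of_smooth hGs).pow 2
      have h1 : L 2 + ∫ s in (2:ℝ)..σ, (deriv G s) ^ 2 = L σ :=
        intervalIntegral.integral_add_adjacent_intervals (hcont.intervalIntegrable _ _)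
          (hcont.intervalIntegrable _ _)
      have h3 : ∫ s in (2:ℝ)..σ, (deriv G s) ^ 2 = c * σ ^ (2 * t - 1) - c * 2 ^ (2 * t - 1) := by
        apply intervalIntegral.integral_eq_sub_of_hasDerivAt_of_le h
        · apply ContinuousOn.mul continuousOn_const
          intro y hy
          exact (Real.continuousAt_rpow_const _ _ (Or.inl (by linarith [hy.1]))).continuousWithinAt
        · intro y hy
          have hy0 : (0:ℝ) < y := by linarith [hy.1]
          have e1 : deriv G y = t * y ^ (t - 1) := by
            have : G =ᶠ[𝓝 y] fun y => y ^ t := by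
              filter_upwards [Ioi_mem_nhds hy.1] with z hz
              exact hG2 z (le_of_lt hz)
            rw [this.deriv_eq]
            exact (Real.hasDerivAt_rpow_const (Or.inl hy0.ne')).deriv
          rw [e1]
          have h4 := (Real.hasDerivAt_rpow_const (x := y) (p := 2 * t - 1) (Or.inl hy0.ne')).const_mul c
          refine h4.congr_deriv ?_
          have : y ^ (2 * t - 1 - 1) = y ^ (t - 1) * y ^ (t - 1) := by
            rw [← Real.rpow_add hy0]; ring_nf
          have hne := h2t.ne'
          rw [this, hc, ← mul_assoc, div_mul_cancel₀ _ hne]; ring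
        · exact hcont.intervalIntegrable _ _
      have : 0 ≤ c * (2:ℝ) ^ (2 * t - 1) := by positivity
      linarith
  -- choose ε
  have hlim : Tendsto (fun ε : ℝ => ε ^ (2 * t - 1) * L 2) (𝓝[>] 0) (𝓝 0) := by
    have h1 : Tendsto (fun ε : ℝ => ε ^ (2 * t - 1)) (𝓝[>] 0) (𝓝 0) := by
      have := (Real.continuousAt_rpow_const (0:ℝ) (2 * t - 1) (Or.inr h2t.le)).tendsto
      rw [Real.zero_rpow h2t.ne'] at this
      exact this.mono_left nhdsWithin_le_nhds
    simpa using h1.mul_const (L 2)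
  have hev : ∀ᶠ ε : ℝ in 𝓝[>] 0, ε ^ (2 * t - 1) * L 2 < δ ∧ ε < δ / 2 ∧ 0 < ε := by
    refine (hlim.eventually (gt_mem_nhds hδ)).and (Eventually.and ?_ self_mem_nhdsWithin)
    exact nhdsWithin_le_nhds (gt_mem_nhds (by linarith))
  obtain ⟨ε, hε1, hε2, hε⟩ := hev.exists
  have hpos1 : (0:ℝ) < ε ^ t := by positivity
  have hpos2 : (0:ℝ) < ε ^ (2 * t - 1) := by positivity
  have hexp : ε ^ t * ε ^ t = ε ^ (2 * t - 1) * ε := by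
    rw [← Real.rpow_add hε]
    nth_rewrite 3 [← Real.rpow_one ε]
    rw [← Real.rpow_add hε]; ring_nf
  refine ⟨fun τ => ε ^ t * G (τ / ε), fun τ => ε ^ (2 * t - 1) * L (τ / ε), ε,
    ⟨hε, ?_, ?_, ?_, ?_⟩, ?_, ?_, ?_, ?_⟩
  · exact contDiff_const.mul (hGs.comp (contDiff_id.div_const _))
  · intro τ
    have h1 : HasDerivAt (fun τ : ℝ => τ / ε) (1 / ε) τ := (hasDerivAt_id τ).div_const _
    have h2 := (((hGs.differentiable (by simp)) (τ / ε)).hasDerivAt.comp τ h1).const_mul (ε ^ t)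
    have h3 := ((primK_hasDeriv hGs 1 (τ / ε)).comp τ h1).const_mul (ε ^ (2 * t - 1))
    have h2' : deriv (fun τ => ε ^ t * G (τ / ε)) τ = _ := h2.deriv
    rw [h2']
    refine h3.congr_deriv ?_
    have : (ε ^ t * (deriv G (τ / ε) * (1 / ε))) ^ 2 =
      (ε ^ t * ε ^ t) * ((deriv G (τ / ε)) ^ 2 * (1 / ε) ^ 2) := by ring
    rw [this, hexp]; field_simp
  · intro τ hτ
    rw [hGz _ (by rw [div_le_one hε]; exact hτ), mul_zero]
  · intro τ hτ
    rw [hL0 _ (by rw [div_le_one hε]; exact hτ), mul_zero]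
  · intro τ; exact mul_nonneg hpos1.le (hGn _)
  · intro τ hτ
    rcases le_total τ δ with h | h
    · exact Or.inl h
    · right
      simp only
      rw [hG2 _ (by rw [le_div_iff₀ hε]; linarith), Real.div_rpow hτ hε.le]
      field_simp
  · intro τ; exact mul_nonneg hpos2.le (hLn _)
  · intro τ hτ
    have h1 := hLb (τ / ε) (by positivity)
    have h2 : ε ^ (2 * t - 1) * L (τ / ε) ≤
        ε ^ (2 * t - 1) * (c * (τ / ε) ^ (2 * t - 1) + L 2) := by gcongr
    rw [Real.div_rpow hτ hε.le] at h2
    have h3 : ε ^ (2 * t - 1) * (c * (τ ^ (2 * t - 1) / ε ^ (2 * t - 1)) + L 2)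
        = c * τ ^ (2 * t - 1) + ε ^ (2 * t - 1) * L 2 := by field_simp
    simp only
    linarith


section cut
variable {n : ℕ} {Ω : Set (EuclideanSpace ℝ (Fin n))} {w : EuclideanSpace ℝ (Fin n) → ℝ}

lemma cut_near_in (hΩ : GoodDomain Ω) (F : ℝ → ℝ) {x} (hx : x ∈ Ω) :
    Ω.indicator (fun x => F (w x)) =ᶠ[𝓝 x] fun x => F (w x) := by
  filter_upwards [hΩ.1.mem_nhds hx] with y hy
  simp [hy]

lemma cut_compact (hΩ : GoodDomain Ω) (hw : Continuous w) (ε : ℝ) :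
    IsCompact (closure Ω ∩ {x | ε ≤ w x}) :=
  (hΩ.2.1.isCompact_closure).inter_right (isClosed_le continuous_const hw)

lemma cut_sub (hΩ : GoodDomain Ω) (hw0 : ∀ x ∈ frontier Ω, w x = 0) {ε : ℝ} (hε : 0 < ε) :
    closure Ω ∩ {x | ε ≤ w x} ⊆ Ω := by
  rintro x ⟨hx, hx2⟩
  by_contra h
  have : x ∈ frontier Ω := by
    rw [frontier, hΩ.1.interior_eq]; exact ⟨hx, h⟩
  have := hw0 x this
  simp only [mem_ofPred_eq] at hx2
  linarith

lemma cut_zero (F : ℝ → ℝ) {ε : ℝ} (hF : ∀ τ ≤ ε, F τ = 0) {x}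
    (hx : x ∉ closure Ω ∩ {x | ε ≤ w x}) : Ω.indicator (fun x => F (w x)) x = 0 := by
  by_cases h : x ∈ Ω
  · rw [indicator_of_mem h]
    apply hF
    by_contra h2
    push Not at h2
    exact hx ⟨subset_closure h, h2.le⟩
  · exact indicator_of_notMem h _

lemma cut_near_out (hΩ : GoodDomain Ω) (hw : Continuous w) (hw0 : ∀ x ∈ frontier Ω, w x = 0)
    (F : ℝ → ℝ) {ε : ℝ} (hε : 0 < ε) (hF : ∀ τ ≤ ε, F τ = 0) {x} (hx : x ∉ Ω) :
    Ω.indicator (fun x => F (w x)) =ᶠ[𝓝 x] fun _ => 0 := by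
  have h1 : x ∈ (closure Ω ∩ {x | ε ≤ w x})ᶜ := fun h => hx (cut_sub hΩ hw0 hε h)
  filter_upwards [(cut_compact hΩ hw ε).isClosed.isOpen_compl.mem_nhds h1] with y hy
  exact cut_zero F hF hy

lemma cut_hcs (hΩ : GoodDomain Ω) (hw : Continuous w)
    (F : ℝ → ℝ) {ε : ℝ} (hF : ∀ τ ≤ ε, F τ = 0) :
    HasCompactSupport (Ω.indicator (fun x => F (w x))) :=
  HasCompactSupport.intro (cut_compact hΩ hw ε) fun _ hx => cut_zero F hF hx

lemma cut_tsupport (hΩ : GoodDomain Ω) (hw : Continuous w) (hw0 : ∀ x ∈ frontier Ω, w x = 0)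
    (F : ℝ → ℝ) {ε : ℝ} (hε : 0 < ε) (hF : ∀ τ ≤ ε, F τ = 0) :
    tsupport (Ω.indicator (fun x => F (w x))) ⊆ Ω := by
  refine Subset.trans (closure_minimal ?_ (cut_compact hΩ hw ε).isClosed) (cut_sub hΩ hw0 hε)
  intro x hx
  by_contra h
  exact hx (cut_zero F hF h)

lemma cut_contDiff (hΩ : GoodDomain Ω) {k : WithTop ℕ∞} (hw : ContDiff ℝ k w)
    (hw0 : ∀ x ∈ frontier Ω, w x = 0)
    (F : ℝ → ℝ) (hFs : ContDiff ℝ k F) {ε : ℝ} (hε : 0 < ε) (hF : ∀ τ ≤ ε, F τ = 0) :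
    ContDiff ℝ k (Ω.indicator (fun x => F (w x))) := by
  rw [contDiff_iff_contDiffAt]
  intro x
  by_cases hx : x ∈ Ω
  · exact (hFs.comp hw).contDiffAt.congr_of_eventuallyEq (cut_near_in hΩ F hx)
  · exact contDiffAt_const.congr_of_eventuallyEq (cut_near_out hΩ hw.continuous hw0 F hε hF hx)

lemma cut_continuous (hΩ : GoodDomain Ω) (hw : Continuous w)
    (hw0 : ∀ x ∈ frontier Ω, w x = 0)
    (F : ℝ → ℝ) (hFs : Continuous F) {ε : ℝ} (hε : 0 < ε) (hF : ∀ τ ≤ ε, F τ = 0) :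
    Continuous (Ω.indicator (fun x => F (w x))) := by
  rw [← contDiff_zero (𝕜 := ℝ)] at *
  exact cut_contDiff hΩ hw hw0 F hFs hε hF

lemma cut_fderiv (hΩ : GoodDomain Ω) (hw : ContDiff ℝ (⊤ : ℕ∞) w)
    (hw0 : ∀ x ∈ frontier Ω, w x = 0)
    (F F' : ℝ → ℝ) (hFd : ∀ τ, HasDerivAt F (F' τ) τ) {ε : ℝ} (hε : 0 < ε)
    (hF : ∀ τ ≤ ε, F τ = 0) (x v : EuclideanSpace ℝ (Fin n)) :
    fderiv ℝ (Ω.indicator (fun x => F (w x))) x v =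
      Ω.indicator (fun x => F' (w x)) x * fderiv ℝ w x v := by
  by_cases hx : x ∈ Ω
  · rw [(cut_near_in hΩ F hx).fderiv_eq, indicator_of_mem hx]
    have h1 : HasFDerivAt w (fderiv ℝ w x) x :=
      ((hw.differentiable (by simp)) x).hasFDerivAt
    have h2 : HasFDerivAt (fun x => F (w x)) (F' (w x) • fderiv ℝ w x) x :=
      (hFd (w x)).comp_hasFDerivAt x h1
    rw [h2.fderiv]; simp
  · rw [(cut_near_out hΩ hw.continuous hw0 F hε hF hx).fderiv_eq, indicator_of_notMem hx]
    simp

lemma lap_eq (hw : ContDiff ℝ (⊤ : ℕ∞) w) (x : EuclideanSpace ℝ (Fin n)) :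
    lap w x = ∑ i : Fin n, fderiv ℝ (fun y => fderiv ℝ w y (EuclideanSpace.single i (1:ℝ))) x
      (EuclideanSpace.single i (1:ℝ)) := by
  unfold lap
  refine Finset.sum_congr rfl fun i _ => ?_
  rw [iteratedFDeriv_two_apply]
  have hd : DifferentiableAt ℝ (fderiv ℝ w) x :=
    ((hw.fderiv_right (m := (⊤ : ℕ∞)) (by simp)).differentiable (by simp)) x
  rw [fderiv_clm_apply hd (differentiableAt_const _)]
  simp

lemma contDiff_pd (hw : ContDiff ℝ (⊤ : ℕ∞) w) (v : EuclideanSpace ℝ (Fin n)) :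
    ContDiff ℝ (⊤ : ℕ∞) (fun y => fderiv ℝ w y v) :=
  (hw.fderiv_right (m := (⊤ : ℕ∞)) (by simp)).clm_apply contDiff_const

lemma lap_smooth (hw : ContDiff ℝ (⊤ : ℕ∞) w) : ContDiff ℝ (⊤ : ℕ∞) (lap w) := by
  have : lap w = fun x => ∑ i : Fin n,
      fderiv ℝ (fun y => fderiv ℝ w y (EuclideanSpace.single i (1:ℝ))) x
      (EuclideanSpace.single i (1:ℝ)) := by
    ext x; exact lap_eq hw x
  rw [this]
  exact ContDiff.sum fun i _ => contDiff_pd (contDiff_pd hw _) _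

lemma norm_grad_sq (φ : EuclideanSpace ℝ (Fin n) → ℝ) (x : EuclideanSpace ℝ (Fin n)) :
    ‖gradient φ x‖ ^ 2 = ∑ i : Fin n, (fderiv ℝ φ x (EuclideanSpace.single i (1:ℝ))) ^ 2 := by
  rw [← OrthonormalBasis.sum_sq_norm_inner_right (EuclideanSpace.basisFun (Fin n) ℝ)]
  refine Finset.sum_congr rfl fun i _ => ?_
  rw [real_inner_comm, gradient, InnerProductSpace.toDual_symm_apply]
  simp

lemma master (hΩ : GoodDomain Ω) (hw : ContDiff ℝ (⊤ : ℕ∞) w)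
    (hw0 : ∀ x ∈ frontier Ω, w x = 0) {G K : ℝ → ℝ} {ε : ℝ} (hT : TestPair G K ε) :
    ContDiff ℝ (⊤ : ℕ∞) (Ω.indicator (fun x => G (w x))) ∧
    HasCompactSupport (Ω.indicator (fun x => G (w x))) ∧
    tsupport (Ω.indicator (fun x => G (w x))) ⊆ Ω ∧
    ∫ x in Ω, ‖gradient (Ω.indicator (fun x => G (w x))) x‖ ^ 2 =
      ∫ x in Ω, K (w x) * (- lap w x) := by
  refine ⟨cut_contDiff hΩ hw hw0 G hT.smooth hT.eps_pos hT.G0, cut_hcs hΩ hw.continuous G hT.G0,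
    cut_tsupport hΩ hw.continuous hw0 G hT.eps_pos hT.G0, ?_⟩
  have hε := hT.eps_pos
  set e : Fin n → EuclideanSpace ℝ (Fin n) := fun i => EuclideanSpace.single i (1:ℝ) with he
  set D : ℝ → ℝ := fun τ => (deriv G τ) ^ 2 with hD
  have hDc : Continuous D := (deriv_cont_of_smooth hT.smooth).pow 2
  have hD0 : ∀ τ ≤ ε / 2, D τ = 0 := by
    intro τ hτ
    have : G =ᶠ[𝓝 τ] fun _ => 0 := by
      filter_upwards [Iio_mem_nhds (show τ < ε by linarith)] with y hy
      exact hT.G0 y (le_of_lt hy)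
    simp [hD, this.deriv_eq]
  have hKc : Continuous K := continuous_iff_continuousAt.2 fun τ => (hT.hK τ).continuousAt
  set Φ : EuclideanSpace ℝ (Fin n) → ℝ := Ω.indicator (fun x => K (w x)) with hΦ
  set Ψ : EuclideanSpace ℝ (Fin n) → ℝ := Ω.indicator (fun x => D (w x)) with hΨ
  have hΦc : Continuous Φ := cut_continuous hΩ hw.continuous hw0 K hKc hε hT.K0
  have hΨc : Continuous Ψ := cut_continuous hΩ hw.continuous hw0 D hDc (half_pos hε) hD0
  have hΦs : HasCompactSupport Φ := cut_hcs hΩ hw.continuous K hT.K0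
  have hΨs : HasCompactSupport Ψ := cut_hcs hΩ hw.continuous D hD0
  have hfd : ∀ x i, fderiv ℝ Φ x (e i) = Ψ x * fderiv ℝ w x (e i) := fun x i =>
    cut_fderiv hΩ hw hw0 K D hT.hK hε hT.K0 x (e i)
  have hdiff : ∀ x, DifferentiableAt ℝ Φ x := by
    intro x
    by_cases hx : x ∈ Ω
    · refine DifferentiableAt.congr_of_eventuallyEq ?_ (cut_near_in hΩ K hx)
      exact (hT.hK (w x)).differentiableAt.comp x ((hw.differentiable (by simp)) x)
    · exact (differentiableAt_const _).congr_of_eventuallyEq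
        (cut_near_out hΩ hw.continuous hw0 K hε hT.K0 hx)
  have hpd : ∀ i, ContDiff ℝ (⊤ : ℕ∞) (fun y => fderiv ℝ w y (e i)) := fun i => contDiff_pd hw _
  have hint1 : ∀ i, Integrable (fun x => fderiv ℝ Φ x (e i) * fderiv ℝ w x (e i)) := by
    intro i
    simp only [hfd]
    refine Continuous.integrable_of_hasCompactSupport ?_ ?_
    · exact (hΨc.mul (hpd i).continuous).mul (hpd i).continuous
    · exact (hΨs.mul_right).mul_right
  have hint2 : ∀ i, Integrable (fun x => Φ x * fderiv ℝ (fun y => fderiv ℝ w y (e i)) x (e i)) := by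
    intro i
    refine Continuous.integrable_of_hasCompactSupport ?_ ?_
    · exact hΦc.mul (contDiff_pd (hpd i) _).continuous
    · exact hΦs.mul_right
  have hibp : ∀ i, ∫ x, Φ x * fderiv ℝ (fun y => fderiv ℝ w y (e i)) x (e i) =
      - ∫ x, fderiv ℝ Φ x (e i) * fderiv ℝ w x (e i) := by
    intro i
    refine integral_mul_fderiv_eq_neg_fderiv_mul_of_integrable (hint1 i) (hint2 i) ?_ ?_ ?_
    · refine Continuous.integrable_of_hasCompactSupport ?_ ?_
      · exact hΦc.mul (hpd i).continuous
      · exact hΦs.mul_right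
    · intro x _; exact hdiff x
    · intro x _; exact ((hpd i).differentiable (by simp)) x
  have hL : ∫ x in Ω, ‖gradient (Ω.indicator (fun x => G (w x))) x‖ ^ 2 =
      ∫ x in Ω, ∑ i, fderiv ℝ Φ x (e i) * fderiv ℝ w x (e i) := by
    refine setIntegral_congr_fun hΩ.1.measurableSet fun x hx => ?_
    rw [norm_grad_sq]
    refine Finset.sum_congr rfl fun i _ => ?_
    rw [cut_fderiv hΩ hw hw0 G (deriv G)
      (fun τ => ((hT.smooth.differentiable (by simp)) τ).hasDerivAt) hε hT.G0, hfd, hΨ,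
      indicator_of_mem hx, indicator_of_mem hx]
    simp only [hD, he]; ring
  have hR : ∫ x in Ω, K (w x) * (- lap w x) =
      ∫ x in Ω, - ∑ i, Φ x * fderiv ℝ (fun y => fderiv ℝ w y (e i)) x (e i) := by
    refine setIntegral_congr_fun hΩ.1.measurableSet fun x hx => ?_
    rw [lap_eq hw, hΦ, indicator_of_mem hx, ← Finset.mul_sum]; ring
  rw [hL, hR, setIntegral_eq_integral_of_forall_compl_eq_zero,
    setIntegral_eq_integral_of_forall_compl_eq_zero, integral_neg,
    integral_finsetSum _ (fun i _ => hint1 i), integral_finsetSum _ (fun i _ => hint2 i),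
    ← Finset.sum_neg_distrib]
  · refine Finset.sum_congr rfl fun i _ => ?_
    rw [hibp i, neg_neg]
  · intro x hx
    simp [hΦ, hx]
  · intro x hx
    simp [hfd, hΨ, hx]
end cut


lemma sob_one (φ : EuclideanSpace ℝ (Fin 1) → ℝ) (hφ : ContDiff ℝ 1 φ)
    (hs : HasCompactSupport φ) (x : EuclideanSpace ℝ (Fin 1)) :
    ‖φ x‖ₑ ≤ eLpNorm (fderiv ℝ φ) 1 volume := by
  have he : ‖(EuclideanSpace.single (0 : Fin 1) (1:ℝ))‖ = 1 := by simp
  let L : ℝ ≃ₗᵢ[ℝ] EuclideanSpace ℝ (Fin 1) :=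
    (LinearIsometry.toSpanSingleton ℝ (EuclideanSpace ℝ (Fin 1)) he).toLinearIsometryEquiv (by simp)
  have hL : MeasurePreserving L volume volume := L.measurePreserving
  have h1 := HasCompactSupport.enorm_le_lintegral_Ici_deriv (f := fun τ => φ (L τ))
    (hφ.comp L.contDiff) (hs.comp_homeomorph L.toHomeomorph) (L.symm x)
  simp only [LinearIsometryEquiv.apply_symm_apply] at h1
  refine h1.trans ?_
  rw [eLpNorm_one_eq_lintegral_enorm, ← hL.lintegral_comp_emb L.toHomeomorph.measurableEmbedding]
  refine (lintegral_mono' Measure.restrict_le_self le_rfl).trans (lintegral_mono fun τ => ?_)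
  have h2 : HasDerivAt (fun τ => φ (L τ)) (fderiv ℝ φ (L τ) (L 1)) τ := by
    have hd := ((hφ.differentiable (by simp)) (L τ)).hasFDerivAt
    have hLd : HasDerivAt (fun τ => L τ) (L 1) τ := L.toContinuousLinearEquiv.toContinuousLinearMap.hasDerivAt
    exact hd.comp_hasDerivAt τ hLd
  rw [h2.deriv]
  have h3 := (fderiv ℝ φ (L τ)).le_opNorm (L 1)
  rw [L.norm_map, norm_one, mul_one] at h3
  exact enorm_le_iff_norm_le.2 h3

lemma norm_grad (n : ℕ) (φ : EuclideanSpace ℝ (Fin n) → ℝ) (x : EuclideanSpace ℝ (Fin n)) :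
    ‖gradient φ x‖ = ‖fderiv ℝ φ x‖ := by
  rw [gradient, LinearIsometryEquiv.norm_map]

lemma sob_aux {n : ℕ} (hn0 : 0 < n) {Ω : Set (EuclideanSpace ℝ (Fin n))} (hΩ : GoodDomain Ω)
    (N : ℝ) (hN6 : 6 ≤ N) (hNn : (n:ℝ) ≤ N) (q : NNReal) (hq : (q:ℝ) = 2 * (N / (N - 2))) :
    ∃ (C : NNReal) (r : NNReal), 1 ≤ r ∧ r ≤ 2 ∧ ∀ φ : EuclideanSpace ℝ (Fin n) → ℝ,
      ContDiff ℝ 1 φ → HasCompactSupport φ → tsupport φ ⊆ Ω →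
      eLpNorm φ q volume ≤ C * eLpNorm (fderiv ℝ φ) r volume := by
  have hN2 : 0 < N - 2 := by linarith
  have hqi : (q:ℝ)⁻¹ = 1 / 2 - 1 / N := by
    rw [hq]; field_simp
  have hNi : 1 / N ≤ 1 / 6 := by gcongr
  rcases Nat.lt_or_ge n 2 with h1 | h2
  · obtain rfl : n = 1 := by omega
    refine ⟨(volume Ω ^ (1 / (q:ℝ))).toNNReal, 1, le_rfl, by norm_num, fun φ hφ hs ht => ?_⟩
    have hsub : φ.support ⊆ Ω := subset_tsupport φ |>.trans ht
    rw [← eLpNorm_restrict_eq_of_support_subset hsub]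
    have hfin : volume Ω ^ (1 / (q:ℝ)) ≠ ⊤ :=
      ENNReal.rpow_ne_top_of_nonneg (by positivity) hΩ.2.1.measure_lt_top.ne
    rw [ENNReal.coe_toNNReal hfin]
    have h1 := eLpNorm_le_eLpNorm_mul_rpow_measure_univ (p := (q : ENNReal)) (q := ⊤)
      (μ := volume.restrict Ω) le_top (hφ.continuous.aestronglyMeasurable (f := φ))
    simp only [ENNReal.coe_toReal, ENNReal.toReal_top, div_zero, sub_zero,
      Measure.restrict_apply_univ] at h1
    refine h1.trans ?_
    rw [mul_comm]
    gcongr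
    rw [eLpNorm_exponent_top]
    refine eLpNormEssSup_le_of_ae_enorm_bound (ae_of_all _ fun x => ?_)
    exact sob_one φ hφ hs x
  · have key : ∃ r : NNReal, 1 ≤ r ∧ r ≤ 2 ∧ (r:ℝ) < n ∧ ((r⁻¹ : NNReal):ℝ) - (n:ℝ)⁻¹ ≤ (q:ℝ)⁻¹ := by
      rcases Nat.lt_or_ge n 3 with h3 | h3
      · obtain rfl : n = 2 := by omega
        refine ⟨6 / 5, ?_, ?_, ?_, ?_⟩
        · rw [← NNReal.coe_le_coe]; push_cast; norm_num
        · rw [← NNReal.coe_le_coe]; push_cast; norm_num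
        · push_cast; norm_num
        · rw [hqi]; push_cast; norm_num; norm_num at hNi; linarith
      · refine ⟨2, by norm_num, le_rfl, ?_, ?_⟩
        · push_cast
          have : (3:ℝ) ≤ n := by exact_mod_cast h3
          linarith
        · rw [hqi]; push_cast
          have h0 : (0:ℝ) < n := by exact_mod_cast hn0
          have : 1 / N ≤ 1 / (n:ℝ) := by gcongr
          rw [one_div, one_div] at *
          linarith
    obtain ⟨r, hr1, hr2, hrn, hrq⟩ := key
    refine ⟨eLpNormLESNormFDerivOfLeConst ℝ volume Ω r q, r, hr1, hr2, fun φ hφ hs ht => ?_⟩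
    refine eLpNorm_le_eLpNorm_fderiv_of_le volume hφ ((subset_tsupport φ).trans ht) hr1 ?_ ?_ hΩ.2.1
    · rw [finrank_euclideanSpace_fin]; exact_mod_cast hrn
    · rw [finrank_euclideanSpace_fin]; exact hrq

lemma sobolev {n : ℕ} (hn0 : 0 < n) {Ω : Set (EuclideanSpace ℝ (Fin n))} (hΩ : GoodDomain Ω)
    (N : ℝ) (hN6 : 6 ≤ N) (hNn : (n:ℝ) ≤ N) :
    ∃ C : ℝ, 0 < C ∧ ∀ φ : EuclideanSpace ℝ (Fin n) → ℝ,
      ContDiff ℝ (⊤ : ℕ∞) φ → HasCompactSupport φ → tsupport φ ⊆ Ω →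
      (∫ x in Ω, |φ x| ^ (2 * (N / (N - 2)))) ^ (1 / (N / (N - 2))) ≤
        C * ∫ x in Ω, ‖gradient φ x‖ ^ 2 := by
  have hN2 : 0 < N - 2 := by linarith
  set χ := N / (N - 2) with hχ
  have hχp : 0 < χ := by positivity
  obtain ⟨C, r, hr1, hr2, h⟩ := sob_aux hn0 hΩ N hN6 hNn ⟨2 * χ, by positivity⟩ rfl
  set q : NNReal := ⟨2 * χ, by positivity⟩ with hq
  have hqr : (q:ℝ) = 2 * χ := rfl
  have hq0 : (q:ENNReal) ≠ 0 := by
    have : q ≠ 0 := by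
      intro h0; rw [h0] at hqr; simp at hqr; exact hχp.ne' hqr
    exact_mod_cast this
  have hfin : ∀ a : ℝ, 0 ≤ a → volume Ω ^ a ≠ ⊤ := fun a ha =>
    ENNReal.rpow_ne_top_of_nonneg ha hΩ.2.1.measure_lt_top.ne
  set T : ENNReal := volume Ω ^ (1 / (r:ENNReal).toReal - 1 / (2:ENNReal).toReal) with hT
  have hTfin : T ≠ ⊤ := by
    refine hfin _ ?_
    have hr1' : (1:ℝ) ≤ r := by exact_mod_cast hr1
    have hr2' : (r:ℝ) ≤ 2 := by exact_mod_cast hr2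
    simp only [ENNReal.coe_toReal, ENNReal.toReal_ofNat, sub_nonneg]
    gcongr
  refine ⟨(C * T.toReal) ^ 2 + 1, by positivity, fun φ hφ hs ht => ?_⟩
  have hφ1 : ContDiff ℝ 1 φ := hφ.of_le (by exact_mod_cast le_top)
  have hsub : φ.support ⊆ Ω := (subset_tsupport φ).trans ht
  have hsub2 : (fderiv ℝ φ).support ⊆ Ω := (support_fderiv_subset ℝ).trans ht
  have hfc : Continuous (fderiv ℝ φ) := hφ1.continuous_fderiv (by simp)
  have h1 := h φ hφ1 hs ht
  rw [← eLpNorm_restrict_eq_of_support_subset (f := φ) hsub,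
    ← eLpNorm_restrict_eq_of_support_subset (f := fderiv ℝ φ) hsub2] at h1
  have h2 : eLpNorm (fderiv ℝ φ) r (volume.restrict Ω) ≤
      eLpNorm (fderiv ℝ φ) 2 (volume.restrict Ω) * T := by
    have := eLpNorm_le_eLpNorm_mul_rpow_measure_univ (p := (r : ENNReal)) (q := 2)
      (μ := volume.restrict Ω) (by exact_mod_cast hr2) (hfc.aestronglyMeasurable (f := fderiv ℝ φ))
    rwa [Measure.restrict_apply_univ] at this
  have m1 : MemLp φ q (volume.restrict Ω) :=
    (hφ.continuous.memLp_of_hasCompactSupport hs).restrict Ω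
  have m2 : MemLp (fderiv ℝ φ) 2 (volume.restrict Ω) :=
    (hfc.memLp_of_hasCompactSupport (hs.fderiv ℝ)).restrict Ω
  have e1 := m1.eLpNorm_eq_integral_rpow_norm hq0 (by simp)
  have e2 := m2.eLpNorm_eq_integral_rpow_norm (by simp) (by simp)
  have h3 := h1.trans (mul_le_mul_right h2 _)
  set X := ∫ x in Ω, |φ x| ^ (2 * χ) with hX
  set Y := ∫ x in Ω, ‖gradient φ x‖ ^ 2 with hY
  have hX0 : 0 ≤ X := integral_nonneg fun x => by positivity
  have hY0 : 0 ≤ Y := integral_nonneg fun x => by positivity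
  have eX : ∫ x in Ω, ‖φ x‖ ^ (q:ENNReal).toReal = X := by
    simp [hX, hqr]
  have eY : ∫ x in Ω, ‖fderiv ℝ φ x‖ ^ (2:ENNReal).toReal = Y := by
    simp [hY, norm_grad]
  rw [eX] at e1
  rw [eY] at e2
  rw [e1, e2] at h3
  have h4 : X ^ (2 * χ)⁻¹ ≤ C * (Y ^ (2:ℝ)⁻¹ * T.toReal) := by
    have h5 := ENNReal.toReal_mono (by finiteness) h3
    simp only [ENNReal.toReal_mul, ENNReal.coe_toReal, ENNReal.toReal_ofNat, hqr] at h5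
    rwa [ENNReal.toReal_ofReal (by positivity), ENNReal.toReal_ofReal (by positivity)] at h5
  have h6 : X ^ (1 / χ) = (X ^ (2 * χ)⁻¹) ^ 2 := by
    rw [← Real.rpow_natCast, ← Real.rpow_mul hX0]
    congr 1; push_cast; field_simp
  have h7 : (Y ^ (2:ℝ)⁻¹) ^ 2 = Y := by
    rw [← Real.rpow_natCast, ← Real.rpow_mul hY0]
    norm_num
  rw [h6]
  calc (X ^ (2 * χ)⁻¹) ^ 2 ≤ (C * (Y ^ (2:ℝ)⁻¹ * T.toReal)) ^ 2 := by gcongr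
    _ = (C * T.toReal) ^ 2 * (Y ^ (2:ℝ)⁻¹) ^ 2 := by ring
    _ = (C * T.toReal) ^ 2 * Y := by rw [h7]
    _ ≤ _ := by nlinarith


section est
variable {n : ℕ} {Ω : Set (EuclideanSpace ℝ (Fin n))} {w : EuclideanSpace ℝ (Fin n) → ℝ}

lemma intOn (hΩ : GoodDomain Ω) {f : EuclideanSpace ℝ (Fin n) → ℝ} (hf : Continuous f) :
    IntegrableOn f Ω :=
  (hf.continuousOn.integrableOn_compact hΩ.2.1.isCompact_closure).mono_set subset_closure

lemma test_pow (hΩ : GoodDomain Ω) (hw : ContDiff ℝ (⊤ : ℕ∞) w)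
    (hw0 : ∀ x ∈ frontier Ω, w x = 0) (hwn : ∀ x ∈ Ω, 0 ≤ w x) (hg : ∀ x ∈ Ω, 0 ≤ - lap w x)
    (t : ℝ) (ht : 1 / 2 < t) (δ : ℝ) (hδ : 0 < δ) :
    ∃ φ : EuclideanSpace ℝ (Fin n) → ℝ, ContDiff ℝ (⊤ : ℕ∞) φ ∧ HasCompactSupport φ ∧
      tsupport φ ⊆ Ω ∧ (∀ x ∈ Ω, 0 ≤ φ x ∧ (w x ≤ δ ∨ φ x = w x ^ t)) ∧
      ∫ x in Ω, ‖gradient φ x‖ ^ 2 ≤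
        t ^ 2 / (2 * t - 1) * (∫ x in Ω, w x ^ (2 * t - 1) * (- lap w x)) +
          δ * ∫ x in Ω, (- lap w x) := by
  obtain ⟨G, K, ε, hT, hG0, hGt, hK0, hKb⟩ := power_pair t ht δ hδ
  obtain ⟨h1, h2, h3, h4⟩ := master hΩ hw hw0 hT
  refine ⟨_, h1, h2, h3, ?_, ?_⟩
  · intro x hx
    rw [indicator_of_mem hx]
    exact ⟨hG0 _, hGt _ (hwn x hx)⟩
  · rw [h4, ← integral_const_mul, ← integral_const_mul]
    have hlc : Continuous (lap w) := (lap_smooth hw).continuous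
    have hwc : Continuous (fun x => w x ^ (2 * t - 1)) :=
      hw.continuous.rpow_const fun x => Or.inr (by linarith)
    have hKc : Continuous K := continuous_iff_continuousAt.2 fun τ => (hT.hK τ).continuousAt
    rw [← integral_add]
    · refine setIntegral_mono_on (intOn hΩ ?_) (intOn hΩ ?_) hΩ.1.measurableSet ?_
      · exact (hKc.comp hw.continuous).mul hlc.neg
      · exact (continuous_const.mul (hwc.mul hlc.neg)).add (continuous_const.mul hlc.neg)
      · intro x hx
        have := mul_le_mul_of_nonneg_right (hKb _ (hwn x hx)) (hg x hx)
        linarith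
    · exact intOn hΩ (continuous_const.mul (hwc.mul hlc.neg))
    · exact intOn hΩ (continuous_const.mul hlc.neg)

lemma rpow_tendsto_zero {a : ℝ} (ha : 0 < a) :
    Tendsto (fun ε : ℝ => ε ^ a) (𝓝[>] 0) (𝓝 0) := by
  have := (Real.continuousAt_rpow_const (0:ℝ) a (Or.inr ha.le)).tendsto
  rw [Real.zero_rpow ha.ne'] at this
  exact this.mono_left nhdsWithin_le_nhds

lemma pow_lower {τ δ y t a : ℝ} (hτ : 0 ≤ τ) (hy : 0 ≤ y) (h : τ ≤ δ ∨ y = τ ^ t)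
    (hδ : 0 < δ) (ha : 0 < t * a) : τ ^ (t * a) - δ ^ (t * a) ≤ y ^ a := by
  rcases h with h | h
  · have h1 : τ ^ (t * a) ≤ δ ^ (t * a) := Real.rpow_le_rpow hτ h ha.le
    have h2 : 0 ≤ y ^ a := Real.rpow_nonneg hy _
    linarith
  · rw [h, ← Real.rpow_mul hτ]
    have : 0 ≤ δ ^ (t * a) := Real.rpow_nonneg hδ.le _
    linarith

lemma stab_pow (hΩ : GoodDomain Ω) (hw : ContDiff ℝ (⊤ : ℕ∞) w)
    (hw0 : ∀ x ∈ frontier Ω, w x = 0) (hwn : ∀ x ∈ Ω, 0 ≤ w x) (hg : ∀ x ∈ Ω, 0 ≤ - lap w x)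
    (t : ℝ) (ht : 1 / 2 < t) {p lam : ℝ} (hp : 1 < p)
    {u : EuclideanSpace ℝ (Fin n) → ℝ} (hu : Continuous u) (hun : ∀ x ∈ Ω, 0 ≤ u x)
    (hst : StabIneq Ω lam (fun t => (1 + t) ^ p) u) :
    √lam * (√p * ∫ x in Ω, (1 + u x) ^ ((p - 1) / 2) * w x ^ (2 * t)) ≤
      t ^ 2 / (2 * t - 1) * (∫ x in Ω, w x ^ (2 * t - 1) * (- lap w x)) := by
  set I := ∫ x in Ω, (1 + u x) ^ ((p - 1) / 2) * w x ^ (2 * t) with hI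
  set J := ∫ x in Ω, (1 + u x) ^ ((p - 1) / 2) with hJ
  set R := ∫ x in Ω, w x ^ (2 * t - 1) * (- lap w x) with hR
  set R1 := ∫ x in Ω, (- lap w x) with hR1
  have hUc : Continuous (fun x => (1 + u x) ^ ((p - 1) / 2)) :=
    (continuous_const.add hu).rpow_const fun x => Or.inr (by linarith)
  have hwc : Continuous (fun x => w x ^ (2 * t)) :=
    hw.continuous.rpow_const fun x => Or.inr (by linarith)
  have key : ∀ δ : ℝ, 0 < δ → √lam * (√p * (I - δ ^ (2 * t) * J)) ≤
      t ^ 2 / (2 * t - 1) * R + δ * R1 := by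
    intro δ hδ
    obtain ⟨φ, h1, h2, h3, h4, h5⟩ := test_pow hΩ hw hw0 hwn hg t ht δ hδ
    refine le_trans ?_ ((hst φ h1 h2 h3).trans h5)
    gcongr
    have e1 : ∫ x in Ω, √(deriv (fun t => (1 + t) ^ p) (u x)) * φ x ^ 2 =
        √p * ∫ x in Ω, (1 + u x) ^ ((p - 1) / 2) * φ x ^ 2 := by
      rw [← integral_const_mul]
      refine setIntegral_congr_fun hΩ.1.measurableSet fun x hx => ?_
      have hpos : 0 < 1 + u x := by linarith [hun x hx]
      have hd : HasDerivAt (fun t : ℝ => (1 + t) ^ p) (p * (1 + u x) ^ (p - 1)) (u x) := by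
        have := ((hasDerivAt_id (u x)).const_add 1).rpow_const (p := p) (Or.inl hpos.ne')
        simpa [mul_comm, mul_assoc] using this
      have e2 : √((1 + u x) ^ (p - 1)) = (1 + u x) ^ ((p - 1) / 2) := by
        rw [Real.sqrt_eq_rpow, ← Real.rpow_mul hpos.le]; congr 1; ring
      simp only [hd.deriv]
      rw [Real.sqrt_mul (by linarith), e2]; ring
    rw [e1]
    gcongr
    rw [hI, hJ, ← integral_const_mul, ← integral_sub]
    · refine setIntegral_mono_on (intOn hΩ ?_) (intOn hΩ ?_) hΩ.1.measurableSet ?_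
      · exact (hUc.mul hwc).sub (continuous_const.mul hUc)
      · exact hUc.mul (h1.continuous.pow 2)
      · intro x hx
        have hpos : 0 < 1 + u x := by linarith [hun x hx]
        have h6 := pow_lower (a := 2) (hwn x hx) (h4 x hx).1 (h4 x hx).2 hδ (by linarith)
        rw [Real.rpow_two, mul_comm t 2] at h6
        have h7 : 0 ≤ (1 + u x) ^ ((p - 1) / 2) := by positivity
        nlinarith
    · exact intOn hΩ (hUc.mul hwc)
    · exact intOn hΩ (continuous_const.mul hUc)
  have hl1 : Tendsto (fun δ : ℝ => √lam * (√p * (I - δ ^ (2 * t) * J))) (𝓝[>] 0)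
      (𝓝 (√lam * (√p * (I - 0 * J)))) :=
    ((((rpow_tendsto_zero (by linarith)).mul_const J).const_sub I).const_mul _).const_mul _
  have hl2 : Tendsto (fun δ : ℝ => t ^ 2 / (2 * t - 1) * R + δ * R1) (𝓝[>] 0)
      (𝓝 (t ^ 2 / (2 * t - 1) * R + 0 * R1)) :=
    ((tendsto_id.mono_left nhdsWithin_le_nhds).mul_const R1).const_add _
  have := le_of_tendsto_of_tendsto hl1 hl2
    (eventually_nhdsWithin_of_forall fun δ hδ => key δ hδ)
  simpa using this

def SobC (Ω : Set (EuclideanSpace ℝ (Fin n))) (χ C : ℝ) : Prop :=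
  ∀ φ : EuclideanSpace ℝ (Fin n) → ℝ,
      ContDiff ℝ (⊤ : ℕ∞) φ → HasCompactSupport φ → tsupport φ ⊆ Ω →
      (∫ x in Ω, |φ x| ^ (2 * χ)) ^ (1 / χ) ≤ C * ∫ x in Ω, ‖gradient φ x‖ ^ 2

lemma sob_pow (hΩ : GoodDomain Ω) (hw : ContDiff ℝ (⊤ : ℕ∞) w)
    (hw0 : ∀ x ∈ frontier Ω, w x = 0) (hwn : ∀ x ∈ Ω, 0 ≤ w x) (hg : ∀ x ∈ Ω, 0 ≤ - lap w x)
    (t : ℝ) (ht : 1 / 2 < t) {χ C : ℝ} (hχ : 0 < χ) (hC : 0 < C) (hS : SobC Ω χ C) :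
    (∫ x in Ω, w x ^ (t * (2 * χ))) ^ (1 / χ) ≤
      C * (t ^ 2 / (2 * t - 1) * (∫ x in Ω, w x ^ (2 * t - 1) * (- lap w x))) := by
  set I := ∫ x in Ω, w x ^ (t * (2 * χ)) with hI
  set R := ∫ x in Ω, w x ^ (2 * t - 1) * (- lap w x) with hR
  set R1 := ∫ x in Ω, (- lap w x) with hR1
  set V := ∫ x in Ω, (1:ℝ) with hV
  have hta : 0 < t * (2 * χ) := by positivity
  have hI0 : 0 ≤ I := setIntegral_nonneg hΩ.1.measurableSet fun x hx =>
    Real.rpow_nonneg (hwn x hx) _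
  have hR0 : 0 ≤ R := setIntegral_nonneg hΩ.1.measurableSet fun x hx =>
    mul_nonneg (Real.rpow_nonneg (hwn x hx) _) (hg x hx)
  have hR10 : 0 ≤ R1 := setIntegral_nonneg hΩ.1.measurableSet fun x hx => hg x hx
  have h2t : 0 < 2 * t - 1 := by linarith
  have hwc : Continuous (fun x => w x ^ (t * (2 * χ))) :=
    hw.continuous.rpow_const fun x => Or.inr hta.le
  have key : ∀ δ : ℝ, 0 < δ → I - δ ^ (t * (2 * χ)) * V ≤
      (C * (t ^ 2 / (2 * t - 1) * R + δ * R1)) ^ χ := by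
    intro δ hδ
    obtain ⟨φ, h1, h2, h3, h4, h5⟩ := test_pow hΩ hw hw0 hwn hg t ht δ hδ
    have h6 := (hS φ h1 h2 h3).trans (mul_le_mul_of_nonneg_left h5 hC.le)
    have hP0 : 0 ≤ ∫ x in Ω, |φ x| ^ (2 * χ) := integral_nonneg fun x => by positivity
    have h7 : ∫ x in Ω, |φ x| ^ (2 * χ) ≤ (C * (t ^ 2 / (2 * t - 1) * R + δ * R1)) ^ χ := by
      have := Real.rpow_le_rpow (by positivity) h6 hχ.le
      rwa [← Real.rpow_mul hP0, one_div_mul_cancel hχ.ne', Real.rpow_one] at this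
    refine le_trans ?_ h7
    rw [hI, hV, ← integral_const_mul, ← integral_sub]
    · refine setIntegral_mono_on (intOn hΩ ?_) (intOn hΩ ?_) hΩ.1.measurableSet ?_
      · exact hwc.sub (continuous_const.mul continuous_const)
      · exact h1.continuous.abs.rpow_const fun x => Or.inr (by positivity)
      · intro x hx
        have h6 := pow_lower (a := 2 * χ) (hwn x hx) (h4 x hx).1 (h4 x hx).2 hδ hta
        rw [abs_of_nonneg (h4 x hx).1, mul_one]
        exact h6
    · exact intOn hΩ hwc
    · exact intOn hΩ (continuous_const.mul continuous_const)
  have hl1 : Tendsto (fun δ : ℝ => I - δ ^ (t * (2 * χ)) * V) (𝓝[>] 0)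
      (𝓝 (I - 0 * V)) :=
    ((rpow_tendsto_zero hta).mul_const V).const_sub I
  have hl2 : Tendsto (fun δ : ℝ => (C * (t ^ 2 / (2 * t - 1) * R + δ * R1)) ^ χ) (𝓝[>] 0)
      (𝓝 ((C * (t ^ 2 / (2 * t - 1) * R + 0 * R1)) ^ χ)) :=
    ((((tendsto_id.mono_left nhdsWithin_le_nhds).mul_const R1).const_add _).const_mul C).rpow_const
      (Or.inr hχ.le)
  have h8 := le_of_tendsto_of_tendsto hl1 hl2
    (eventually_nhdsWithin_of_forall fun δ hδ => key δ hδ)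
  simp only [zero_mul, sub_zero, add_zero] at h8
  have h9 := Real.rpow_le_rpow hI0 h8 (one_div_pos.2 hχ).le
  rwa [← Real.rpow_mul (by positivity), mul_one_div_cancel hχ.ne', Real.rpow_one] at h9
end est


section est2
variable {n : ℕ} {Ω : Set (EuclideanSpace ℝ (Fin n))} {w : EuclideanSpace ℝ (Fin n) → ℝ}

lemma finOn (hΩ : GoodDomain Ω) : IsFiniteMeasure (volume.restrict Ω) :=
  ⟨by rw [Measure.restrict_apply_univ]; exact hΩ.2.1.measure_lt_top⟩

lemma memLpOn (hΩ : GoodDomain Ω) {f : EuclideanSpace ℝ (Fin n) → ℝ} (hf : Continuous f)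
    (q : ENNReal) : MemLp f q (volume.restrict Ω) := by
  have := finOn hΩ
  obtain ⟨B, hB⟩ := (hΩ.2.1.isCompact_closure).exists_bound_of_continuousOn hf.continuousOn
  refine MemLp.of_bound hf.aestronglyMeasurable B ?_
  exact (ae_restrict_mem hΩ.1.measurableSet).mono fun x hx => hB x (subset_closure hx)

lemma holderOn (hΩ : GoodDomain Ω) {f g : EuclideanSpace ℝ (Fin n) → ℝ} (hf : Continuous f)
    (hg : Continuous g) (hf0 : ∀ x ∈ Ω, 0 ≤ f x) (hg0 : ∀ x ∈ Ω, 0 ≤ g x) {a b : ℝ}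
    (hab : a.HolderConjugate b) :
    ∫ x in Ω, f x * g x ≤ (∫ x in Ω, f x ^ a) ^ (1 / a) * (∫ x in Ω, g x ^ b) ^ (1 / b) :=
  integral_mul_le_Lp_mul_Lq_of_nonneg hab
    ((ae_restrict_mem hΩ.1.measurableSet).mono fun x hx => hf0 x hx)
    ((ae_restrict_mem hΩ.1.measurableSet).mono fun x hx => hg0 x hx)
    (memLpOn hΩ hf _) (memLpOn hΩ hg _)

/-- superlevel measure -/
def mu (Ω : Set (EuclideanSpace ℝ (Fin n))) (w : EuclideanSpace ℝ (Fin n) → ℝ) (h : ℝ) : ℝ :=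
  (volume.restrict Ω).real {x | h ≤ w x}

lemma mu_anti (hΩ : GoodDomain Ω) {a h : ℝ} (hah : a ≤ h) : mu Ω w h ≤ mu Ω w a := by
  have := finOn hΩ
  exact measureReal_mono fun x hx => le_trans hah hx

lemma mu_zero_bound (hΩ : GoodDomain Ω) (hw : Continuous w) {h : ℝ} (h0 : mu Ω w h = 0) :
    ∀ x ∈ Ω, w x ≤ h := by
  have := finOn hΩ
  intro x hx
  by_contra hlt
  push Not at hlt
  have hopen : IsOpen ({x | h < w x} ∩ Ω) := (isOpen_lt continuous_const hw).inter hΩ.1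
  have hpos : 0 < volume ({x | h < w x} ∩ Ω) := hopen.measure_pos _ ⟨x, hlt, hx⟩
  have h1 : (volume.restrict Ω) {x | h ≤ w x} = 0 := by
    rwa [mu, measureReal_eq_zero_iff] at h0
  have h2 : (volume.restrict Ω) {x | h < w x} = 0 :=
    measure_mono_null
      (show {x | h < w x} ⊆ {x | h ≤ w x} from fun y (hy : h < w y) => le_of_lt hy) h1
  rw [Measure.restrict_apply (isOpen_lt continuous_const hw).measurableSet] at h2
  exact hpos.ne' h2

lemma sob_stamp (hΩ : GoodDomain Ω) (hw : ContDiff ℝ (⊤ : ℕ∞) w)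
    (hw0 : ∀ x ∈ frontier Ω, w x = 0) {χ C : ℝ} (hχ : 0 < χ) (hS : SobC Ω χ C)
    {G K : ℝ → ℝ} {ε h : ℝ} (hT : TestPair G K ε) (hG1 : ∀ τ, h ≤ τ → G τ = 1) :
    (mu Ω w h) ^ (1 / χ) ≤ C * ∫ x in Ω, K (w x) * (- lap w x) := by
  have := finOn hΩ
  obtain ⟨h1, h2, h3, h4⟩ := master hΩ hw hw0 hT
  have h5 := hS _ h1 h2 h3
  rw [h4] at h5
  refine le_trans (Real.rpow_le_rpow measureReal_nonneg ?_ (by positivity)) h5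
  have hm : MeasurableSet {x | h ≤ w x} :=
    (isClosed_le continuous_const hw.continuous).measurableSet
  rw [mu, ← integral_indicator_one hm]
  refine setIntegral_mono_on ?_ (intOn hΩ ?_) hΩ.1.measurableSet ?_
  · exact (integrable_const (1:ℝ)).indicator hm
  · exact h1.continuous.abs.rpow_const fun x => Or.inr (by positivity)
  · intro x hx
    by_cases hxh : h ≤ w x
    · rw [indicator_of_mem (show x ∈ {x | h ≤ w x} from hxh), indicator_of_mem hx, hG1 _ hxh]
      simp
    · rw [indicator_of_notMem (show x ∉ {x | h ≤ w x} from hxh)]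
      positivity

lemma lap_const_mul (hw : ContDiff ℝ (⊤ : ℕ∞) w) (c : ℝ) (x : EuclideanSpace ℝ (Fin n)) :
    lap (fun x => c * w x) x = c * lap w x := by
  unfold lap
  rw [Finset.mul_sum]
  refine Finset.sum_congr rfl fun i _ => ?_
  have : (fun x => c * w x) = c • w := by ext; simp
  rw [this, iteratedFDeriv_const_smul_apply (hw.contDiffAt.of_le (by
    have : ((2:ℕ∞) : WithTop ℕ∞) ≤ ((⊤:ℕ∞) : WithTop ℕ∞) := WithTop.coe_le_coe.2 le_top
    exact this))]
  simp

lemma max_prin (hΩ : GoodDomain Ω) (hw : ContDiff ℝ (⊤ : ℕ∞) w)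
    (hw0 : ∀ x ∈ frontier Ω, w x = 0) (hg : ∀ x ∈ Ω, 0 ≤ - lap w x)
    {χ C : ℝ} (hχ : 0 < χ) (hC : 0 < C) (hS : SobC Ω χ C) : ∀ x ∈ Ω, 0 ≤ w x := by
  have hw' : ContDiff ℝ (⊤ : ℕ∞) (fun x => (-1) * w x) := contDiff_const.mul hw
  have key : ∀ h : ℝ, 0 < h → ∀ x ∈ Ω, (-1) * w x ≤ h := by
    intro h hh
    refine mu_zero_bound hΩ hw'.continuous ?_
    obtain ⟨M, hM, hMM⟩ := stamp_pair
    obtain ⟨G, K, ε, hT, hG0, hG1, hK0, hKM, hKa⟩ := hMM (h / 2) h (by linarith) (by linarith)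
    have h1 := sob_stamp hΩ hw' (fun x hx => by simp [hw0 x hx]) hχ hS hT hG1
    have h2 : ∫ x in Ω, K ((-1) * w x) * (- lap (fun x => (-1) * w x) x) ≤ 0 := by
      refine setIntegral_nonpos hΩ.1.measurableSet fun x hx => ?_
      rw [lap_const_mul hw]
      have := hg x hx
      have := hK0 ((-1) * w x)
      nlinarith
    have h3 : (mu Ω (fun x => (-1) * w x) h) ^ (1 / χ) ≤ 0 := h1.trans (by nlinarith)
    have h4 : 0 ≤ mu Ω (fun x => (-1) * w x) h := measureReal_nonneg
    have h5 := le_antisymm h3 (Real.rpow_nonneg h4 _)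
    exact (Real.rpow_eq_zero h4 (by positivity)).1 h5
  intro x hx
  have : (-1) * w x ≤ 0 := le_of_forall_pos_le_add fun h hh => by simpa using key h hh x hx
  linarith

lemma seq_decay {x : ℕ → ℝ} (hx : ∀ j, 0 ≤ x j) {E b β X ρ : ℝ} (hβ : 1 < β) (hE : 0 ≤ E)
    (hb : 0 ≤ b) (hX : 0 < X) (hρ : 0 < ρ) (h1 : E * X ^ (β - 1) ≤ ρ) (h2 : b * ρ ^ (β - 1) ≤ 1)
    (h0 : x 0 ≤ X) (hrec : ∀ j, x (j + 1) ≤ E * b ^ j * x j ^ β) :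
    ∀ j, x j ≤ X * ρ ^ j := by
  intro j
  induction j with
  | zero => simpa using h0
  | succ j ih =>
    have e1 : (X * ρ ^ j) ^ β = X ^ (β - 1) * X * (ρ ^ (β - 1)) ^ j * ρ ^ j := by
      have hpos : 0 < X * ρ ^ j := by positivity
      have : (X * ρ ^ j) ^ β = (X * ρ ^ j) ^ (β - 1) * (X * ρ ^ j) := by
        rw [Real.rpow_sub_one hpos.ne']; field_simp
      rw [this, Real.mul_rpow hX.le (by positivity), ← Real.rpow_natCast ρ j,
        ← Real.rpow_mul hρ.le, mul_comm (j:ℝ) (β - 1), Real.rpow_mul hρ.le, Real.rpow_natCast]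
      ring
    calc x (j + 1) ≤ E * b ^ j * x j ^ β := hrec j
      _ ≤ E * b ^ j * (X * ρ ^ j) ^ β := by
          gcongr
          exact hx j
      _ = (E * X ^ (β - 1)) * (b * ρ ^ (β - 1)) ^ j * (X * ρ ^ j) := by rw [e1, mul_pow]; ring
      _ ≤ ρ * 1 * (X * ρ ^ j) := by
          gcongr
          exact pow_le_one₀ (by positivity) h2
      _ = X * ρ ^ (j + 1) := by ring

lemma stampacchia (hΩ : GoodDomain Ω) {χ C κ : ℝ} (hχ : 0 < χ) (hC : 0 < C) (hS : SobC Ω χ C)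
    (hκ : 1 < κ) (hβ : 1 < χ * (1 - 1 / κ)) :
    ∃ L : ℝ, 0 < L ∧ ∀ w : EuclideanSpace ℝ (Fin n) → ℝ, ContDiff ℝ (⊤ : ℕ∞) w →
      (∀ x ∈ frontier Ω, w x = 0) → (∀ x ∈ Ω, 0 ≤ - lap w x) →
      ∀ x ∈ Ω, w x ≤ L * ((∫ x in Ω, (- lap w x) ^ κ) ^ (1 / κ) + 1) := by
  have := finOn hΩ
  obtain ⟨M, hM, hMM⟩ := stamp_pair
  set β := χ * (1 - 1 / κ) with hβd
  set X := (volume.restrict Ω).real univ + 1 with hX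
  have hX0 : 0 < X := by
    have : 0 ≤ (volume.restrict Ω).real univ := measureReal_nonneg
    positivity
  set ρ : ℝ := 2 ^ (-(χ / (β - 1))) with hρ
  have hβ1 : 0 < β - 1 := by linarith
  have hρ0 : 0 < ρ := by positivity
  have hρ1 : ρ < 1 := Real.rpow_lt_one_of_one_lt_of_neg (by norm_num) (by
    have : 0 < χ / (β - 1) := by positivity
    linarith)
  set ℓ : ℝ := 2 * (X ^ (β - 1) / ρ) ^ (1 / χ) with hℓ
  have hℓ0 : 0 < ℓ := by positivity
  refine ⟨2 * (C * M * ℓ), by positivity, fun w hw hw0 hg => ?_⟩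
  set J := (∫ x in Ω, (- lap w x) ^ κ) ^ (1 / κ) with hJ
  have hI0 : 0 ≤ ∫ x in Ω, (- lap w x) ^ κ :=
    setIntegral_nonneg hΩ.1.measurableSet fun x hx => Real.rpow_nonneg (hg x hx) _
  have hJ0 : 0 ≤ J := Real.rpow_nonneg hI0 _
  set D := C * M * (J + 1) with hD
  have hD0 : 0 < D := by positivity
  set d := D * ℓ with hd
  have hd0 : 0 < d := by positivity
  have hmu0 : ∀ h, 0 ≤ mu Ω w h := fun h => measureReal_nonneg
  have hκc : (Real.conjExponent κ).HolderConjugate κ := (Real.HolderConjugate.conjExponent hκ).symm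
  have hlc : Continuous (lap w) := (lap_smooth hw).continuous
  have step : ∀ a h, 0 < a → a < h → mu Ω w h ≤ (D / (h - a)) ^ χ * mu Ω w a ^ β := by
    intro a h ha hah
    have hha : 0 < h - a := by linarith
    obtain ⟨G, K, ε, hT, hG0, hG1, hK0, hKM, hKa⟩ := hMM a h ha hah
    have h1 := sob_stamp hΩ hw hw0 hχ hS hT hG1
    have hm : MeasurableSet {x | a ≤ w x} :=
      (isClosed_le continuous_const hw.continuous).measurableSet
    have hKc : Continuous K := continuous_iff_continuousAt.2 fun τ => (hT.hK τ).continuousAt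
    have hind : MemLp ({x | a ≤ w x}.indicator (1 : EuclideanSpace ℝ (Fin n) → ℝ))
        (ENNReal.ofReal (Real.conjExponent κ)) (volume.restrict Ω) :=
      (memLp_const (1:ℝ)).indicator hm
    have h2 : ∫ x in Ω, K (w x) * (- lap w x) ≤ M / (h - a) *
        ∫ x in Ω, {x | a ≤ w x}.indicator (1 : EuclideanSpace ℝ (Fin n) → ℝ) x * (- lap w x) := by
      rw [← integral_const_mul]
      refine setIntegral_mono_on (intOn hΩ ((hKc.comp hw.continuous).mul hlc.neg)) ?_
        hΩ.1.measurableSet ?_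
      · refine Integrable.const_mul ?_ _
        have : (fun x => {x | a ≤ w x}.indicator (1 : EuclideanSpace ℝ (Fin n) → ℝ) x * (- lap w x))
            = {x | a ≤ w x}.indicator (fun x => - lap w x) := by
          ext x
          by_cases hx : x ∈ {x | a ≤ w x}
          · simp [indicator_of_mem hx]
          · simp [indicator_of_notMem hx]
        rw [this]
        exact Integrable.indicator (intOn hΩ hlc.neg) hm
      · intro x hx
        by_cases hxa : x ∈ {x | a ≤ w x}
        · rw [indicator_of_mem hxa, Pi.one_apply, one_mul]
          exact mul_le_mul_of_nonneg_right (hKM _) (hg x hx)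
        · rw [indicator_of_notMem hxa, hKa _ (le_of_lt (not_le.1 hxa))]
          simp
    have h3 := integral_mul_le_Lp_mul_Lq_of_nonneg (μ := volume.restrict Ω) hκc
      (f := {x | a ≤ w x}.indicator (1 : EuclideanSpace ℝ (Fin n) → ℝ)) (g := fun x => - lap w x)
      (ae_of_all _ fun x => indicator_nonneg (fun _ _ => zero_le_one) x)
      ((ae_restrict_mem hΩ.1.measurableSet).mono fun x hx => hg x hx) hind (memLpOn hΩ hlc.neg _)
    have h4 : ∫ x in Ω, ({x | a ≤ w x}.indicator (1 : EuclideanSpace ℝ (Fin n) → ℝ) x) ^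
        (Real.conjExponent κ) = mu Ω w a := by
      rw [mu, ← integral_indicator_one hm]
      refine integral_congr_ae (ae_of_all _ fun x => ?_)
      by_cases hxa : x ∈ {x | a ≤ w x}
      · simp [indicator_of_mem hxa]
      · simp [indicator_of_notMem hxa, Real.zero_rpow hκc.ne_zero]
    rw [h4] at h3
    have h5 : 1 / Real.conjExponent κ = 1 - 1 / κ := by
      have := hκc.inv_add_inv_eq_one
      rw [one_div, one_div]; linarith
    rw [h5] at h3
    have h6 : mu Ω w h ^ (1 / χ) ≤ D / (h - a) * mu Ω w a ^ (1 - 1 / κ) := by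
      refine h1.trans ?_
      have h7 : 0 ≤ mu Ω w a ^ (1 - 1 / κ) := Real.rpow_nonneg (hmu0 a) _
      calc C * ∫ x in Ω, K (w x) * (- lap w x)
          ≤ C * (M / (h - a) * (mu Ω w a ^ (1 - 1 / κ) * J)) := by
            refine mul_le_mul_of_nonneg_left (h2.trans ?_) hC.le
            exact mul_le_mul_of_nonneg_left h3 (by positivity)
        _ ≤ C * (M / (h - a) * (mu Ω w a ^ (1 - 1 / κ) * (J + 1))) := by
            gcongr; linarith
        _ = _ := by rw [hD]; ring
    have h8 := Real.rpow_le_rpow (Real.rpow_nonneg (hmu0 h) _) h6 hχ.le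
    rw [← Real.rpow_mul (hmu0 h), one_div_mul_cancel hχ.ne', Real.rpow_one,
      Real.mul_rpow (by positivity) (Real.rpow_nonneg (hmu0 a) _), ← Real.rpow_mul (hmu0 a),
      mul_comm (1 - 1 / κ) χ] at h8
    exact h8
  set hh : ℕ → ℝ := fun j => d * (2 - (1 / 2) ^ j) with hhd
  have hhle : ∀ j, d ≤ hh j ∧ hh j ≤ 2 * d := by
    intro j
    have e1 : (0:ℝ) < (1 / 2) ^ j := by positivity
    have e2 : ((1:ℝ) / 2) ^ j ≤ 1 := pow_le_one₀ (by norm_num) (by norm_num)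
    simp only [hhd]
    constructor <;> nlinarith
  have hdec := seq_decay (x := fun j => mu Ω w (hh j)) (fun j => hmu0 _)
    (E := (2 / ℓ) ^ χ) (b := 2 ^ χ) (β := β) (X := X) (ρ := ρ) hβ (by positivity) (by positivity)
    hX0 hρ0 ?_ ?_ ?_ ?_
  · have hz : mu Ω w (2 * d) = 0 := by
      refine le_antisymm ?_ (hmu0 _)
      have hl : Tendsto (fun j : ℕ => X * ρ ^ j) atTop (𝓝 (X * 0)) :=
        (tendsto_pow_atTop_nhds_zero_of_lt_one hρ0.le hρ1).const_mul X
      rw [mul_zero] at hl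
      exact ge_of_tendsto' hl fun j => (mu_anti hΩ (hhle j).2).trans (hdec j)
    intro x hx
    have := mu_zero_bound hΩ hw.continuous hz x hx
    refine this.trans (le_of_eq ?_)
    rw [hd, hD]; ring
  · have : (2 / ℓ) ^ χ = ρ / X ^ (β - 1) := by
      rw [hℓ, ← div_div, div_self (two_ne_zero), Real.div_rpow (by norm_num) (by positivity),
        Real.one_rpow, ← Real.rpow_mul (by positivity), one_div_mul_cancel hχ.ne', Real.rpow_one,
        one_div_div]
    rw [this, div_mul_cancel₀ _ (by positivity)]
  · rw [hρ, ← Real.rpow_mul (by norm_num), ← Real.rpow_add (by norm_num)]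
    have : χ + -(χ / (β - 1)) * (β - 1) = 0 := by field_simp; ring
    rw [this, Real.rpow_zero]
  · have : mu Ω w (hh 0) ≤ (volume.restrict Ω).real univ := measureReal_mono (subset_univ _)
    show mu Ω w (hh 0) ≤ X
    linarith
  · intro j
    have e : hh (j + 1) - hh j = d * (1 / 2) ^ (j + 1) := by simp only [hhd]; ring
    have epos : 0 < d * (1 / 2 : ℝ) ^ (j + 1) := by positivity
    have h1 := step (hh j) (hh (j + 1)) (by linarith [(hhle j).1]) (by linarith)
    rw [e] at h1
    refine h1.trans (le_of_eq ?_)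
    congr 1
    have e3 : D / (d * (1 / 2) ^ (j + 1)) = 2 / ℓ * 2 ^ j := by
      rw [hd, one_div, inv_pow]; field_simp; ring
    rw [e3, Real.mul_rpow (by positivity) (by positivity), ← Real.rpow_natCast 2 j,
      ← Real.rpow_natCast (2 ^ χ) j, ← Real.rpow_mul (by norm_num), ← Real.rpow_mul (by norm_num),
      mul_comm χ]
end est2


lemma choose_s {p αstar N : ℝ} (hp : 1 < p)
    (hroot : (p + 1) ^ 2 * αstar ^ 4 - 8 * p * (p + 1) * αstar ^ 2
      + 4 * p * (p + 3) * αstar - 4 * p = 0)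
    (hmax : ∀ β : ℝ, (p + 1) ^ 2 * β ^ 4 - 8 * p * (p + 1) * β ^ 2
      + 4 * p * (p + 3) * β - 4 * p = 0 → β ≤ αstar)
    (hN : N ≤ 6 ∨ N < 4 * (p + 1) / (p - 1) * αstar + 2) :
    ∃ s : ℝ, 1 < s ∧ (p + 1) ^ 2 * s ^ 4 - 8 * p * (p + 1) * s ^ 2
      + 4 * p * (p + 3) * s - 4 * p < 0 ∧ N < 4 * (p + 1) / (p - 1) * s + 2 := by
  have h1 : 1 < αstar := by
    set P : ℝ → ℝ := fun β => (p + 1) ^ 2 * β ^ 4 - 8 * p * (p + 1) * β ^ 2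
      + 4 * p * (p + 3) * β - 4 * p with hP
    have hc : ContinuousOn P (Icc 1 (8 * p)) := by
      apply Continuous.continuousOn; fun_prop
    have hP1 : P 1 < 0 := by
      simp only [hP]; nlinarith
    have hP2 : 0 < P (8 * p) := by
      simp only [hP]
      have e : (p + 1) ^ 2 * (8 * p) ^ 4 - 8 * p * (p + 1) * (8 * p) ^ 2
        + 4 * p * (p + 3) * (8 * p) - 4 * p
        = (8 * p) ^ 2 * (p + 1) * (64 * p ^ 2 * (p + 1) - 8 * p) + 4 * p * (8 * p * (p + 3) - 1) := by
        ring
      rw [e]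
      have a1 : 0 < 64 * p ^ 2 * (p + 1) - 8 * p := by nlinarith
      have a2 : 0 < 8 * p * (p + 3) - 1 := by nlinarith
      have : 0 < p := by linarith
      positivity
    obtain ⟨β, hβ, hβ0⟩ := intermediate_value_Icc (by linarith : (1:ℝ) ≤ 8 * p) hc
      (show (0:ℝ) ∈ Icc (P 1) (P (8 * p)) from ⟨hP1.le, hP2.le⟩)
    have h2 := hmax β hβ0
    rcases eq_or_lt_of_le hβ.1 with h | h
    · rw [← h] at hβ0; linarith
    · linarith
  have hneg : ∀ s, 1 < s → s < αstar → (p + 1) ^ 2 * s ^ 4 - 8 * p * (p + 1) * s ^ 2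
      + 4 * p * (p + 3) * s - 4 * p < 0 := by
    intro s hs1 hs2
    obtain ⟨x, rfl⟩ : ∃ x, s = 1 + x := ⟨s - 1, by ring⟩
    obtain ⟨y, rfl⟩ : ∃ y, αstar = 1 + y := ⟨αstar - 1, by ring⟩
    have hx : 0 < x := by linarith
    have hxy : x < y := by linarith
    have hy : 0 < y := by linarith
    have key : ((p + 1) ^ 2 * (1 + x) ^ 4 - 8 * p * (p + 1) * (1 + x) ^ 2
      + 4 * p * (p + 3) * (1 + x) - 4 * p) * y ^ 2 - ((p + 1) ^ 2 * (1 + y) ^ 4 -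
        8 * p * (p + 1) * (1 + y) ^ 2 + 4 * p * (p + 3) * (1 + y) - 4 * p) * x ^ 2
      = -((y - x) * ((p + 1) ^ 2 * (x + y) * x ^ 2 * y ^ 2 + 4 * (p + 1) ^ 2 * x ^ 2 * y ^ 2
        + 4 * (p - 1) * (2 * p + 1) * x * y + (p - 1) * (1 + 3 * p) * (x + y))) := by
      ring
    rw [hroot, zero_mul, sub_zero] at key
    have h3 : 0 < (y - x) * ((p + 1) ^ 2 * (x + y) * x ^ 2 * y ^ 2 + 4 * (p + 1) ^ 2 * x ^ 2 * y ^ 2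
        + 4 * (p - 1) * (2 * p + 1) * x * y + (p - 1) * (1 + 3 * p) * (x + y)) := by
      have : 0 < y - x := by linarith
      have : 0 < p - 1 := by linarith
      have : 0 < p := by linarith
      positivity
    by_contra hcon
    push Not at hcon
    have := mul_nonneg hcon (sq_nonneg y)
    linarith
  have hp1 : 0 < p - 1 := by linarith
  set K := 4 * (p + 1) / (p - 1) with hK
  have hK4 : 4 < K := by rw [hK, lt_div_iff₀ hp1]; linarith
  have hNN : N < K * αstar + 2 := by
    rcases hN with h | h
    · nlinarith
    · exact h
  have hm : max 1 ((N - 2) / K) < αstar := by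
    refine max_lt h1 ?_
    rw [div_lt_iff₀ (by linarith)]; linarith
  obtain ⟨s, hs1, hs2⟩ := exists_between hm
  have hs3 := (le_max_left _ _).trans_lt hs1
  refine ⟨s, hs3, hneg s hs3 hs2, ?_⟩
  have := (le_max_right _ _).trans_lt hs1
  rw [div_lt_iff₀ (by linarith)] at this
  linarith

lemma pw_ineq {η q T : ℝ} (hη : 0 < η) (hq : 0 ≤ q) (hT : 0 < T) :
    ∃ C : ℝ, 0 ≤ C ∧ ∀ τ : ℝ, 0 ≤ τ →
      (1 + τ) ^ q * (1 + τ) ^ T ≤ (1 + η) * ((1 + τ) ^ q * τ ^ T) + C := by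
  set z := (1 + η) ^ (1 / T) with hz
  have hz1 : 1 < z := Real.one_lt_rpow (by linarith) (by positivity)
  set L := 1 / (z - 1) with hL
  have hL0 : 0 < L := by rw [hL]; exact one_div_pos.2 (by linarith)
  refine ⟨(1 + L) ^ q * (1 + L) ^ T, by positivity, fun τ hτ => ?_⟩
  rcases le_total τ L with h | h
  · have : (1 + τ) ^ q * (1 + τ) ^ T ≤ (1 + L) ^ q * (1 + L) ^ T := by gcongr
    have h2 : 0 ≤ (1 + η) * ((1 + τ) ^ q * τ ^ T) := by positivity
    linarith
  · have h1 : 1 + τ ≤ z * τ := by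
      have : 1 ≤ (z - 1) * τ := by
        have : (z - 1) * L = 1 := by rw [hL]; field_simp [show z - 1 ≠ 0 by linarith]
        nlinarith
      linarith
    have h2 : (1 + τ) ^ T ≤ (1 + η) * τ ^ T := by
      refine (Real.rpow_le_rpow (by positivity) h1 hT.le).trans (le_of_eq ?_)
      rw [Real.mul_rpow (by linarith) hτ, hz, ← Real.rpow_mul (by linarith),
        one_div_mul_cancel hT.ne', Real.rpow_one]
    have h3 := mul_le_mul_of_nonneg_left h2 (show 0 ≤ (1 + τ) ^ q by positivity)
    have h4 : 0 ≤ (1 + L) ^ q * (1 + L) ^ T := by positivity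
    linarith

/-- division step `x ≤ c x^(1-θ) y ⇒ x^θ ≤ c y` -/
lemma div_step {x y c θ : ℝ} (hx : 0 ≤ x) (hy : 0 ≤ y) (hc : 0 ≤ c) (hθ : 0 < θ)
    (h : x ≤ c * (x ^ (1 - θ) * y)) : x ^ θ ≤ c * y := by
  rcases hx.eq_or_lt with h0 | h0
  · rw [← h0, Real.zero_rpow hθ.ne']; positivity
  · have hp : 0 < x ^ (1 - θ) := by positivity
    have e : x = x ^ (1 - θ) * x ^ θ := by rw [← Real.rpow_add h0]; simp
    refine le_of_mul_le_mul_left ?_ hp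
    rw [← e]; linarith

section main
variable {n : ℕ} {Ω : Set (EuclideanSpace ℝ (Fin n))}

structure Sys (Ω : Set (EuclideanSpace ℝ (Fin n))) (p μ : ℝ)
    (u v : EuclideanSpace ℝ (Fin n) → ℝ) : Prop where
  hu : ContDiff ℝ (⊤ : ℕ∞) u
  hv : ContDiff ℝ (⊤ : ℕ∞) v
  hu0 : ∀ x ∈ frontier Ω, u x = 0
  hv0 : ∀ x ∈ frontier Ω, v x = 0
  hun : ∀ x ∈ Ω, 0 ≤ u x
  hvn : ∀ x ∈ Ω, 0 ≤ v x
  hlu : ∀ x ∈ Ω, - lap u x = μ * v x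
  hlv : ∀ x ∈ Ω, - lap v x = μ * (1 + u x) ^ p

variable {p μ : ℝ} {u v : EuclideanSpace ℝ (Fin n) → ℝ}

lemma cont_pow {f : EuclideanSpace ℝ (Fin n) → ℝ} (hf : Continuous f) {a : ℝ} (ha : 0 ≤ a) :
    Continuous fun x => f x ^ a := hf.rpow_const fun _ => Or.inr ha

lemma nn_int (hΩ : GoodDomain Ω) {f : EuclideanSpace ℝ (Fin n) → ℝ} (h : ∀ x ∈ Ω, 0 ≤ f x) :
    0 ≤ ∫ x in Ω, f x := setIntegral_nonneg hΩ.1.measurableSet h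

lemma hold1 (hΩ : GoodDomain Ω) (h : Sys Ω p μ u v) (hp : 1 < p) {s : ℝ} (hs : 1 < s) :
    ∫ x in Ω, u x ^ (2 * (s * (p + 1) / 2) - 1) * v x ≤
      (∫ x in Ω, (1 + u x) ^ ((p - 1) / 2) * (1 + u x) ^ (2 * (s * (p + 1) / 2))) ^ (1 - 1 / (2 * s))
      * (∫ x in Ω, (1 + u x) ^ ((p - 1) / 2) * v x ^ (2 * s)) ^ (1 / (2 * s)) := by
  have hθ1 : 1 / (2 * s) < 1 := by rw [div_lt_one (by linarith)]; linarith
  have hθ0 : 0 < 1 / (2 * s) := by positivity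
  set θ := 1 / (2 * s) with hθ
  have hsθ : s * θ = 1 / 2 := by rw [hθ]; field_simp
  set t := s * (p + 1) / 2 with ht
  have ht1 : 1 < t := by rw [ht]; nlinarith
  have htθ : 2 * t * θ = (p + 1) / 2 := by rw [ht]; linear_combination (p + 1) * hsθ
  set q := (p - 1) / 2 with hq
  have hq0 : 0 < q := by rw [hq]; linarith
  have hc := h.hu.continuous
  have hcv := h.hv.continuous
  have hcU : Continuous fun x => 1 + u x := continuous_const.add hc
  have hab : (1 / (1 - θ)).HolderConjugate (2 * s) := by
    rw [Real.holderConjugate_iff]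
    constructor
    · rw [lt_div_iff₀ (by linarith)]; linarith
    · rw [one_div, inv_inv, ← one_div, ← hθ]; ring
  have H := holderOn hΩ (f := fun x => (1 + u x) ^ ((q + 2 * t) * (1 - θ)))
    (g := fun x => (1 + u x) ^ (q * θ) * v x)
    (cont_pow hcU (mul_nonneg (by linarith) (by linarith)))
    ((cont_pow hcU (by positivity)).mul hcv)
    (fun x hx => Real.rpow_nonneg (by linarith [h.hun x hx]) _)
    (fun x hx => mul_nonneg (Real.rpow_nonneg (by linarith [h.hun x hx]) _) (h.hvn x hx)) hab
  rw [one_div_one_div] at H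
  have e1 : ∫ x in Ω, ((1 + u x) ^ ((q + 2 * t) * (1 - θ))) ^ (1 / (1 - θ))
      = ∫ x in Ω, (1 + u x) ^ q * (1 + u x) ^ (2 * t) := by
    refine setIntegral_congr_fun hΩ.1.measurableSet fun x hx => ?_
    have hU : 0 < 1 + u x := by linarith [h.hun x hx]
    show ((1 + u x) ^ ((q + 2 * t) * (1 - θ))) ^ (1 / (1 - θ)) = _
    rw [← Real.rpow_mul hU.le, ← Real.rpow_add hU, mul_assoc, mul_one_div_cancel (by linarith), mul_one]
  have e2 : ∫ x in Ω, ((1 + u x) ^ (q * θ) * v x) ^ (2 * s)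
      = ∫ x in Ω, (1 + u x) ^ q * v x ^ (2 * s) := by
    refine setIntegral_congr_fun hΩ.1.measurableSet fun x hx => ?_
    have hU : 0 < 1 + u x := by linarith [h.hun x hx]
    show ((1 + u x) ^ (q * θ) * v x) ^ (2 * s) = _
    rw [Real.mul_rpow (by positivity) (h.hvn x hx), ← Real.rpow_mul hU.le]
    congr 2
    linear_combination 2 * q * hsθ
  rw [e1, e2] at H
  refine le_trans ?_ H
  refine setIntegral_mono_on (intOn hΩ ((cont_pow hc (by linarith)).mul hcv))
    (intOn hΩ ((cont_pow hcU (mul_nonneg (by linarith) (by linarith))).mul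
      ((cont_pow hcU (by positivity)).mul hcv))) hΩ.1.measurableSet fun x hx => ?_
  have hU : 0 < 1 + u x := by linarith [h.hun x hx]
  rw [← mul_assoc, ← Real.rpow_add hU]
  refine mul_le_mul_of_nonneg_right ?_ (h.hvn x hx)
  have e3 : (q + 2 * t) * (1 - θ) + q * θ = 2 * t - 1 := by
    rw [hq]; linear_combination -htθ
  rw [e3]
  exact Real.rpow_le_rpow (h.hun x hx) (by linarith) (by linarith)

lemma hold2 (hΩ : GoodDomain Ω) (h : Sys Ω p μ u v) (hp : 1 < p) {s : ℝ} (hs : 1 < s) :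
    ∫ x in Ω, v x ^ (2 * s - 1) * (1 + u x) ^ p ≤
      (∫ x in Ω, (1 + u x) ^ ((p - 1) / 2) * v x ^ (2 * s)) ^ (1 - 1 / (2 * s)) *
      (∫ x in Ω, (1 + u x) ^ ((p - 1) / 2) * (1 + u x) ^ (2 * (s * (p + 1) / 2))) ^ (1 / (2 * s))
      := by
  have hθ1 : 1 / (2 * s) < 1 := by rw [div_lt_one (by linarith)]; linarith
  have hθ0 : 0 < 1 / (2 * s) := by positivity
  set θ := 1 / (2 * s) with hθ
  have hsθ : s * θ = 1 / 2 := by rw [hθ]; field_simp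
  set t := s * (p + 1) / 2 with ht
  have ht1 : 1 < t := by rw [ht]; nlinarith
  have htθ : 2 * t * θ = (p + 1) / 2 := by rw [ht]; linear_combination (p + 1) * hsθ
  set q := (p - 1) / 2 with hq
  have hq0 : 0 < q := by rw [hq]; linarith
  have hc := h.hu.continuous
  have hcv := h.hv.continuous
  have hcU : Continuous fun x => 1 + u x := continuous_const.add hc
  have hab : (1 / (1 - θ)).HolderConjugate (2 * s) := by
    rw [Real.holderConjugate_iff]
    constructor
    · rw [lt_div_iff₀ (by linarith)]; linarith
    · rw [one_div, inv_inv, ← one_div, ← hθ]; ring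
  have h1θ : 0 < 1 - θ := by linarith
  have H := holderOn hΩ (f := fun x => (1 + u x) ^ (q * (1 - θ)) * v x ^ (2 * s - 1))
    (g := fun x => (1 + u x) ^ ((q + 2 * t) * θ))
    ((cont_pow hcU (by positivity)).mul (cont_pow hcv (by linarith)))
    (cont_pow hcU (mul_nonneg (by linarith) (by linarith)))
    (fun x hx => mul_nonneg (Real.rpow_nonneg (by linarith [h.hun x hx]) _)
      (Real.rpow_nonneg (h.hvn x hx) _))
    (fun x hx => Real.rpow_nonneg (by linarith [h.hun x hx]) _) hab
  rw [one_div_one_div] at H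
  have e1 : ∫ x in Ω, ((1 + u x) ^ (q * (1 - θ)) * v x ^ (2 * s - 1)) ^ (1 / (1 - θ))
      = ∫ x in Ω, (1 + u x) ^ q * v x ^ (2 * s) := by
    refine setIntegral_congr_fun hΩ.1.measurableSet fun x hx => ?_
    have hU : 0 < 1 + u x := by linarith [h.hun x hx]
    have hV := h.hvn x hx
    show ((1 + u x) ^ (q * (1 - θ)) * v x ^ (2 * s - 1)) ^ (1 / (1 - θ)) = _
    rw [Real.mul_rpow (by positivity) (by positivity), ← Real.rpow_mul hU.le, ← Real.rpow_mul hV,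
      mul_assoc, mul_one_div_cancel h1θ.ne', mul_one]
    congr 2
    rw [mul_one_div, div_eq_iff h1θ.ne']
    linear_combination 2 * hsθ
  have e2 : ∫ x in Ω, ((1 + u x) ^ ((q + 2 * t) * θ)) ^ (2 * s)
      = ∫ x in Ω, (1 + u x) ^ q * (1 + u x) ^ (2 * t) := by
    refine setIntegral_congr_fun hΩ.1.measurableSet fun x hx => ?_
    have hU : 0 < 1 + u x := by linarith [h.hun x hx]
    show ((1 + u x) ^ ((q + 2 * t) * θ)) ^ (2 * s) = _
    rw [← Real.rpow_mul hU.le, ← Real.rpow_add hU]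
    congr 1
    linear_combination 2 * (q + 2 * t) * hsθ
  rw [e1, e2] at H
  refine le_trans (le_of_eq ?_) H
  refine setIntegral_congr_fun hΩ.1.measurableSet fun x hx => ?_
  have hU : 0 < 1 + u x := by linarith [h.hun x hx]
  show _ = (1 + u x) ^ (q * (1 - θ)) * v x ^ (2 * s - 1) * (1 + u x) ^ ((q + 2 * t) * θ)
  have e3 : p = q * (1 - θ) + (q + 2 * t) * θ := by
    rw [hq]; linear_combination -htθ
  conv_lhs => rw [e3]
  rw [Real.rpow_add hU]
  ring

/-- first integral estimate -/
lemma est1 (hΩ : GoodDomain Ω) (h : Sys Ω p μ u v) (hp : 1 < p) (hμ : 0 < μ) {lam : ℝ}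
    (hl : √lam = μ) (hst : StabIneq Ω lam (fun t => (1 + t) ^ p) u) {s : ℝ} (hs : 1 < s)
    {t : ℝ} (ht : t = s * (p + 1) / 2) :
    √p * (∫ x in Ω, (1 + u x) ^ ((p - 1) / 2) * u x ^ (2 * t)) ≤
      t ^ 2 / (2 * t - 1) * (∫ x in Ω, u x ^ (2 * t - 1) * v x) ∧
    √p * (∫ x in Ω, u x ^ (2 * t - 1) * v x) ≤ s ^ 2 / (2 * s - 1) *
      ∫ x in Ω, (1 + u x) ^ ((p - 1) / 2) * (1 + u x) ^ (2 * t) := by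
  have ht1 : 1 < t := by rw [ht]; nlinarith
  have hc := h.hu.continuous
  have hg1 : ∀ x ∈ Ω, 0 ≤ - lap u x := fun x hx => by
    rw [h.hlu x hx]; exact mul_nonneg hμ.le (h.hvn x hx)
  have hg2 : ∀ x ∈ Ω, 0 ≤ - lap v x := fun x hx => by
    rw [h.hlv x hx]; exact mul_nonneg hμ.le (Real.rpow_nonneg (by linarith [h.hun x hx]) _)
  have S1 := stab_pow hΩ h.hu h.hu0 h.hun hg1 t (by linarith) hp hc h.hun hst
  have S2 := stab_pow hΩ h.hv h.hv0 h.hvn hg2 s (by linarith) hp hc h.hun hst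
  have e1 : ∫ x in Ω, u x ^ (2 * t - 1) * (- lap u x) = μ * ∫ x in Ω, u x ^ (2 * t - 1) * v x := by
    rw [← integral_const_mul]
    refine setIntegral_congr_fun hΩ.1.measurableSet fun x hx => ?_
    show u x ^ (2 * t - 1) * (- lap u x) = _
    rw [h.hlu x hx]; ring
  have e2 : ∫ x in Ω, v x ^ (2 * s - 1) * (- lap v x)
      = μ * ∫ x in Ω, v x ^ (2 * s - 1) * (1 + u x) ^ p := by
    rw [← integral_const_mul]
    refine setIntegral_congr_fun hΩ.1.measurableSet fun x hx => ?_
    show v x ^ (2 * s - 1) * (- lap v x) = _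
    rw [h.hlv x hx]; ring
  rw [hl, e1, mul_left_comm (t ^ 2 / (2 * t - 1))] at S1
  rw [hl, e2, mul_left_comm (s ^ 2 / (2 * s - 1))] at S2
  have S1' := le_of_mul_le_mul_left S1 hμ
  have S2' := le_of_mul_le_mul_left S2 hμ
  refine ⟨S1', ?_⟩
  have H1 := hold1 hΩ h hp hs
  have H2 := hold2 hΩ h hp hs
  rw [← ht] at H1 H2
  set A := ∫ x in Ω, (1 + u x) ^ ((p - 1) / 2) * (1 + u x) ^ (2 * t) with hA
  set B := ∫ x in Ω, (1 + u x) ^ ((p - 1) / 2) * v x ^ (2 * s) with hB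
  have hA0 : 0 ≤ A := nn_int hΩ fun x hx => by
    have := h.hun x hx; positivity
  have hB0 : 0 ≤ B := nn_int hΩ fun x hx => by
    have := h.hun x hx; have := h.hvn x hx; positivity
  have hθ1 : 1 / (2 * s) < 1 := by rw [div_lt_one (by linarith)]; linarith
  have hθ0 : 0 < 1 / (2 * s) := by positivity
  set θ := 1 / (2 * s) with hθ
  have hsp : 0 < √p := Real.sqrt_pos.2 (by linarith)
  have hs2 : 0 < s ^ 2 / (2 * s - 1) := div_pos (by positivity) (by linarith)
  set c := s ^ 2 / (2 * s - 1) with hc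
  have D := div_step (c := c / √p) hB0 (Real.rpow_nonneg hA0 θ) (by positivity) hθ0 (by
    have := S2'.trans (mul_le_mul_of_nonneg_left H2 hs2.le)
    rw [div_mul_eq_mul_div, le_div_iff₀ hsp]; linarith)
  have D2 : √p * B ^ θ ≤ c * A ^ θ := by
    rw [div_mul_eq_mul_div, le_div_iff₀ hsp] at D; linarith
  have e4 : A ^ (1 - θ) * A ^ θ = A := by
    rw [← Real.rpow_add_of_nonneg hA0 (by linarith) hθ0.le]; simp
  calc _ ≤ √p * (A ^ (1 - θ) * B ^ θ) := by gcongr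
    _ = A ^ (1 - θ) * (√p * B ^ θ) := by ring
    _ ≤ A ^ (1 - θ) * (c * A ^ θ) := by gcongr
    _ = c * A := by rw [← mul_assoc, mul_comm _ c, mul_assoc, e4]

/-- uniform bound for A -/
lemma A_bound (hΩ : GoodDomain Ω) (hp : 1 < p) {s : ℝ} (hs : 1 < s)
    (hPs : (p + 1) ^ 2 * s ^ 4 - 8 * p * (p + 1) * s ^ 2 + 4 * p * (p + 3) * s - 4 * p < 0)
    {t : ℝ} (ht : t = s * (p + 1) / 2) :
    ∃ A0 : ℝ, 0 ≤ A0 ∧ ∀ μ lam u v, Sys Ω p μ u v → 0 < μ → √lam = μ →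
      StabIneq Ω lam (fun t => (1 + t) ^ p) u →
      ∫ x in Ω, (1 + u x) ^ ((p - 1) / 2) * (1 + u x) ^ (2 * t) ≤ A0 := by
  have ht1 : 1 < t := by rw [ht]; nlinarith
  set c := t ^ 2 / (2 * t - 1) * (s ^ 2 / (2 * s - 1)) / p with hc
  have hc1 : c < 1 := by
    rw [hc, div_mul_div_comm, div_div, div_lt_one (by
      have : 0 < 2 * t - 1 := by linarith
      have : 0 < 2 * s - 1 := by linarith
      have : 0 < p := by linarith
      positivity)]
    rw [ht]; nlinarith
  have hc0 : 0 < c := by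
    have : 0 < 2 * t - 1 := by linarith
    have : 0 < 2 * s - 1 := by linarith
    have : 0 < p := by linarith
    positivity
  set η := (1 - c) / (2 * c) with hη
  have hη0 : 0 < η := div_pos (by linarith) (by linarith)
  have hηc : (1 + η) * c = (1 + c) / 2 := by rw [hη]; field_simp; ring
  obtain ⟨C, hC0, hC⟩ := pw_ineq (q := (p - 1) / 2) (T := 2 * t) hη0 (by linarith) (by linarith)
  set V := ∫ x in Ω, C with hV
  have hV0 : 0 ≤ V := nn_int hΩ fun x _ => hC0
  refine ⟨2 * V / (1 - c), div_nonneg (by positivity) (by linarith), ?_⟩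
  intro μ lam u v h hμ hl hst
  obtain ⟨E1, E2⟩ := est1 hΩ h hp hμ hl hst hs ht
  set A := ∫ x in Ω, (1 + u x) ^ ((p - 1) / 2) * (1 + u x) ^ (2 * t) with hA
  set I := ∫ x in Ω, (1 + u x) ^ ((p - 1) / 2) * u x ^ (2 * t) with hI
  set J := ∫ x in Ω, u x ^ (2 * t - 1) * v x with hJ
  have hc' := h.hu.continuous
  have hcU : Continuous fun x => 1 + u x := continuous_const.add hc'
  have hI1 : I ≤ c * A := by
    have h1 : 0 < t ^ 2 / (2 * t - 1) := div_pos (by positivity) (by linarith)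
    have hpp : √p * √p = p := Real.mul_self_sqrt (by linarith)
    have h2 : p * I ≤ t ^ 2 / (2 * t - 1) * (s ^ 2 / (2 * s - 1)) * A := by
      calc p * I = √p * (√p * I) := by rw [← mul_assoc, hpp]
        _ ≤ √p * (t ^ 2 / (2 * t - 1) * J) := by gcongr
        _ = t ^ 2 / (2 * t - 1) * (√p * J) := by ring
        _ ≤ t ^ 2 / (2 * t - 1) * (s ^ 2 / (2 * s - 1) * A) := by gcongr
        _ = _ := by ring
    rw [hc, div_mul_eq_mul_div, le_div_iff₀ (by linarith)]; linarith
  have hAI : A ≤ (1 + η) * I + V := by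
    have i1 : IntegrableOn (fun x => (1 + η) * ((1 + u x) ^ ((p - 1) / 2) * u x ^ (2 * t))) Ω :=
      intOn hΩ (continuous_const.mul ((cont_pow hcU (by linarith)).mul (cont_pow hc' (by linarith))))
    have i2 : IntegrableOn (fun _ : EuclideanSpace ℝ (Fin n) => C) Ω := intOn hΩ continuous_const
    rw [hI, hV, ← integral_const_mul, ← integral_add i1 i2]
    refine setIntegral_mono_on (intOn hΩ ((cont_pow hcU (by linarith)).mul
      (cont_pow hcU (by linarith)))) (i1.add i2) hΩ.1.measurableSet fun x hx => ?_
    exact hC _ (h.hun x hx)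
  have h5 : A ≤ (1 + c) / 2 * A + V := by
    have := mul_le_mul_of_nonneg_left hI1 (show 0 ≤ 1 + η by linarith)
    rw [← mul_assoc, hηc] at this
    linarith
  rw [le_div_iff₀ (by linarith)]
  linarith

end main

section main2
variable {n : ℕ} {Ω : Set (EuclideanSpace ℝ (Fin n))}
variable {p μ : ℝ} {u v : EuclideanSpace ℝ (Fin n) → ℝ}

lemma mu_bound (hΩ : GoodDomain Ω) (hp : 1 < p) :
    ∃ μ0 : ℝ, ∀ (lam : ℝ) (u : EuclideanSpace ℝ (Fin n) → ℝ), Continuous u →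
      (∀ x ∈ Ω, 0 ≤ u x) → StabIneq Ω lam (fun t => (1 + t) ^ p) u → √lam ≤ μ0 := by
  obtain ⟨x0, hx0⟩ := hΩ.2.2
  obtain ⟨ε, hε, hball⟩ := Metric.isOpen_iff.1 hΩ.1 x0 hx0
  let φ : ContDiffBump x0 := ⟨ε / 4, ε / 2, by linarith, by linarith⟩
  have hφs : tsupport φ ⊆ Ω := by
    rw [φ.tsupport_eq]
    exact (Metric.closedBall_subset_ball (by show ε / 2 < ε; linarith)).trans hball
  have hφc : Continuous (φ : EuclideanSpace ℝ (Fin n) → ℝ) := φ.continuous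
  have hpos : 0 < ∫ x in Ω, φ x ^ 2 := by
    rw [setIntegral_pos_iff_support_of_nonneg_ae
      (Eventually.of_forall fun x => sq_nonneg (φ x)) (intOn hΩ (hφc.pow 2))]
    have ho : IsOpen (Function.support (fun x => φ x ^ 2) ∩ Ω) :=
      ((hφc.pow 2).isOpen_support).inter hΩ.1
    refine ho.measure_pos _ ⟨x0, ?_, hx0⟩
    have h1 : φ x0 = 1 := φ.one_of_mem_closedBall (Metric.mem_closedBall_self φ.rIn_pos.le)
    simp [Function.mem_support, h1]
  refine ⟨(∫ x in Ω, ‖gradient φ x‖ ^ 2) / ∫ x in Ω, φ x ^ 2, fun lam u hu hun hst => ?_⟩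
  rw [le_div_iff₀ hpos]
  refine le_trans ?_ (hst φ φ.contDiff φ.hasCompactSupport hφs)
  refine mul_le_mul_of_nonneg_left ?_ (Real.sqrt_nonneg _)
  have hUc : Continuous (fun x => √p * (1 + u x) ^ ((p - 1) / 2)) :=
    continuous_const.mul ((continuous_const.add hu).rpow_const fun x => Or.inr (by linarith))
  have e1 : ∫ x in Ω, √(deriv (fun t => (1 + t) ^ p) (u x)) * φ x ^ 2 =
        ∫ x in Ω, √p * (1 + u x) ^ ((p - 1) / 2) * φ x ^ 2 := by
      refine setIntegral_congr_fun hΩ.1.measurableSet fun x hx => ?_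
      have hpos : 0 < 1 + u x := by linarith [hun x hx]
      have hd : HasDerivAt (fun t : ℝ => (1 + t) ^ p) (p * (1 + u x) ^ (p - 1)) (u x) := by
        have := ((hasDerivAt_id (u x)).const_add 1).rpow_const (p := p) (Or.inl hpos.ne')
        simpa [mul_comm, mul_assoc] using this
      have e2 : √((1 + u x) ^ (p - 1)) = (1 + u x) ^ ((p - 1) / 2) := by
        rw [Real.sqrt_eq_rpow, ← Real.rpow_mul hpos.le]; congr 1; ring
      simp only [hd.deriv]
      rw [Real.sqrt_mul (by linarith), e2]
  rw [e1]
  refine setIntegral_mono_on (intOn hΩ (hφc.pow 2)) (intOn hΩ (hUc.mul (hφc.pow 2)))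
    hΩ.1.measurableSet fun x hx => ?_
  have h1 : 1 ≤ √p := Real.one_le_sqrt.2 hp.le
  have h2 : 1 ≤ (1 + u x) ^ ((p - 1) / 2) :=
    Real.one_le_rpow (by linarith [hun x hx]) (by linarith)
  have h3 : 1 ≤ √p * (1 + u x) ^ ((p - 1) / 2) := one_le_mul_of_one_le_of_one_le h1 h2
  nlinarith [sq_nonneg (φ x)]

/-- Lemma E -/
lemma lemE (hΩ : GoodDomain Ω) (h : Sys Ω p μ u v) (hp : 1 < p) (hμ : 0 < μ)
    {χ C k k1 : ℝ} (hχ : 0 < χ) (hC : 0 < C) (hS : SobC Ω χ C) (hk : 1 < k) (hk1 : 0 < k1)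
    (hkk : 1 / χ - (1 - 1 / k) = 1 / k1) {t : ℝ} (ht : t = k1 / (2 * χ)) :
    (∫ x in Ω, v x ^ k1) ^ (1 / k1) ≤
      C * (t ^ 2 / (2 * t - 1)) * μ * (∫ x in Ω, (1 + u x) ^ (p * k)) ^ (1 / k) := by
  have h1k : 0 < 1 - 1 / k := by
    have : 1 / k < 1 := by rw [div_lt_one (by linarith)]; exact hk
    linarith
  have e0 : 2 * t - 1 = k1 * (1 - 1 / k) := by
    have : 2 * t = k1 * (1 / χ) := by rw [ht]; field_simp
    rw [this]
    have h2 : k1 * (1 / k1) = 1 := mul_one_div_cancel hk1.ne'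
    rw [← hkk] at h2
    linarith
  have ht0 : 0 < 2 * t - 1 := by rw [e0]; positivity
  have hg2 : ∀ x ∈ Ω, 0 ≤ - lap v x := fun x hx => by
    rw [h.hlv x hx]; exact mul_nonneg hμ.le (Real.rpow_nonneg (by linarith [h.hun x hx]) _)
  have S := sob_pow hΩ h.hv h.hv0 h.hvn hg2 t (by linarith) hχ hC hS
  have e1 : t * (2 * χ) = k1 := by rw [ht]; field_simp
  rw [e1] at S
  have e2 : ∫ x in Ω, v x ^ (2 * t - 1) * (- lap v x)
      = μ * ∫ x in Ω, v x ^ (2 * t - 1) * (1 + u x) ^ p := by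
    rw [← integral_const_mul]
    refine setIntegral_congr_fun hΩ.1.measurableSet fun x hx => ?_
    show v x ^ (2 * t - 1) * (- lap v x) = _
    rw [h.hlv x hx]; ring
  rw [e2] at S
  have hcv := h.hv.continuous
  have hcU : Continuous fun x => 1 + u x := continuous_const.add h.hu.continuous
  have hab : (1 / (1 - 1 / k)).HolderConjugate k := by
    rw [Real.holderConjugate_iff]
    constructor
    · rw [lt_div_iff₀ h1k]
      have : 0 < 1 / k := by positivity
      linarith
    · rw [one_div, inv_inv, one_div]; ring
  have H := holderOn hΩ (f := fun x => v x ^ (2 * t - 1)) (g := fun x => (1 + u x) ^ p)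
    (cont_pow hcv ht0.le) (cont_pow hcU (by linarith))
    (fun x hx => Real.rpow_nonneg (h.hvn x hx) _)
    (fun x hx => Real.rpow_nonneg (by linarith [h.hun x hx]) _) hab
  rw [one_div_one_div] at H
  have e3 : ∫ x in Ω, (v x ^ (2 * t - 1)) ^ (1 / (1 - 1 / k)) = ∫ x in Ω, v x ^ k1 := by
    refine setIntegral_congr_fun hΩ.1.measurableSet fun x hx => ?_
    show (v x ^ (2 * t - 1)) ^ (1 / (1 - 1 / k)) = _
    rw [← Real.rpow_mul (h.hvn x hx), e0, mul_assoc, mul_one_div_cancel h1k.ne', mul_one]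
  have e4 : ∫ x in Ω, ((1 + u x) ^ p) ^ k = ∫ x in Ω, (1 + u x) ^ (p * k) := by
    refine setIntegral_congr_fun hΩ.1.measurableSet fun x hx => ?_
    show ((1 + u x) ^ p) ^ k = _
    rw [← Real.rpow_mul (by linarith [h.hun x hx])]
  rw [e3, e4] at H
  set V := ∫ x in Ω, v x ^ k1 with hV
  set W := (∫ x in Ω, (1 + u x) ^ (p * k)) ^ (1 / k) with hW
  have hV0 : 0 ≤ V := nn_int hΩ fun x hx => Real.rpow_nonneg (h.hvn x hx) _
  have hW0 : 0 ≤ W := Real.rpow_nonneg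
    (nn_int hΩ fun x hx => Real.rpow_nonneg (by linarith [h.hun x hx]) _) _
  set K := C * (t ^ 2 / (2 * t - 1)) * μ with hK
  have hK0 : 0 < K := by
    have : 0 < t := by linarith
    positivity
  have S2 : V ^ (1 / χ) ≤ K * (V ^ (1 - 1 / k) * W) := by
    refine S.trans ?_
    have := mul_le_mul_of_nonneg_left H hK0.le
    refine le_trans (le_of_eq ?_) this
    rw [hK]; ring
  rcases hV0.eq_or_lt with h0 | h0
  · rw [← h0, Real.zero_rpow (by positivity)]; positivity
  · have e5 : V ^ (1 / χ) = V ^ (1 - 1 / k) * V ^ (1 / k1) := by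
      rw [← Real.rpow_add h0]; congr 1; linarith
    rw [e5] at S2
    have hp : 0 < V ^ (1 - 1 / k) := by positivity
    refine le_of_mul_le_mul_left ?_ hp
    linarith

set_option maxHeartbeats 2000000 in
lemma core (hΩ : GoodDomain Ω) (hp : 1 < p) {N C s : ℝ} (hN6 : 6 ≤ N) (hC : 0 < C)
    (hS : SobC Ω (N / (N - 2)) C) (hs : 1 < s)
    (hPs : (p + 1) ^ 2 * s ^ 4 - 8 * p * (p + 1) * s ^ 2 + 4 * p * (p + 3) * s - 4 * p < 0)
    (hNs : N < 4 * (p + 1) / (p - 1) * s + 2) :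
    ∃ M0 : ℝ, ∀ μ lam u v, Sys Ω p μ u v → 0 < μ → √lam = μ →
      StabIneq Ω lam (fun t => (1 + t) ^ p) u → ∀ x ∈ Ω, u x ≤ M0 := by
  set χ := N / (N - 2) with hχd
  have hχ : 0 < χ := div_pos (by linarith) (by linarith)
  obtain ⟨t, ht⟩ : ∃ t, t = s * (p + 1) / 2 := ⟨_, rfl⟩
  have ht1 : 1 < t := by rw [ht]; nlinarith
  obtain ⟨A0, hA0, hA⟩ := A_bound hΩ hp hs hPs ht
  obtain ⟨μ0, hμ0⟩ := mu_bound hΩ hp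
  set r := t * (2 * χ) with hr
  have hr0 : 0 < r := by positivity
  have hp1 : 0 < p - 1 := by linarith
  have hrN : N / 4 < r / (p - 1) := by
    have h1 : (N - 2) * (p - 1) < 4 * (p + 1) * s := by
      have h2 : N - 2 < 4 * (p + 1) * s / (p - 1) := by
        rw [mul_div_right_comm]; linarith
      rwa [lt_div_iff₀ hp1] at h2
    have e : r = s * (p + 1) * N / (N - 2) := by rw [hr, ht, hχd]; ring
    rw [e, div_div, div_lt_div_iff₀ (by norm_num) (mul_pos (by linarith) hp1)]
    nlinarith
  obtain ⟨k, hk1, hk2⟩ := exists_between (lt_min hrN (show N / 4 < N / 2 by linarith))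
  have hkr : k < r / (p - 1) := hk2.trans_le (min_le_left _ _)
  have hkN : k < N / 2 := hk2.trans_le (min_le_right _ _)
  have hk : 1 < k := by linarith
  obtain ⟨k1, hk1d⟩ : ∃ k1, k1 = 1 / (1 / k - 2 / N) := ⟨_, rfl⟩
  have hkp : 0 < 1 / k - 2 / N := by
    rw [sub_pos, div_lt_div_iff₀ (by linarith) (by linarith)]; linarith
  have hk1p : 0 < k1 := by rw [hk1d]; positivity
  have hik1 : 1 / k1 = 1 / k - 2 / N := by rw [hk1d, one_div_one_div]
  have hiχ : 1 / χ = 1 - 2 / N := by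
    rw [hχd, one_div_div]; field_simp
  have hik1N : 1 / k1 < 2 / N := by
    have : 1 / k < 4 / N := by
      rw [div_lt_div_iff₀ (by linarith) (by linarith)]; linarith
    rw [hik1]
    have e : (4:ℝ) / N = 2 / N + 2 / N := by ring
    linarith
  have hN13 : 2 / N ≤ 1 / 3 := by
    rw [div_le_div_iff₀ (by linarith) (by norm_num)]; linarith
  have hk1g : 1 < k1 := by
    have : 1 / k1 < 1 := by linarith
    rwa [div_lt_one hk1p] at this
  have hβ : 1 < χ * (1 - 1 / k1) := by
    have h1 : χ * (1 / χ) = 1 := mul_one_div_cancel hχ.ne'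
    have : χ * (1 / χ) < χ * (1 - 1 / k1) := by
      apply mul_lt_mul_of_pos_left _ hχ
      rw [hiχ]; linarith
    linarith
  obtain ⟨L, hL, hstamp⟩ := stampacchia hΩ hχ hC hS hk1g hβ
  obtain ⟨Cp, hCp0, hCp⟩ := pw_ineq (η := 1) (q := 0) (T := r) one_pos le_rfl hr0
  set r' := min r (p * k) with hr'
  have hr'1 : (p - 1) * k < r' := by
    refine lt_min ?_ (by nlinarith)
    rw [lt_div_iff₀ hp1] at hkr; linarith
  have hr'2 : r' ≤ p * k := min_le_right _ _
  have hr'3 : r' ≤ r := min_le_left _ _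
  set θ := (p * k - r') / k with hθ
  have hk0 : 0 < k := by linarith
  have hθ0 : 0 ≤ θ := div_nonneg (by linarith) hk0.le
  have hθ1 : θ < 1 := by rw [hθ, div_lt_one hk0]; linarith
  -- constants
  set c2 := s ^ 2 / (2 * s - 1) with hc2
  have hc20 : 0 < c2 := div_pos (by positivity) (by linarith)
  set ct := t ^ 2 / (2 * t - 1) with hct
  have hct0 : 0 < ct := div_pos (by positivity) (by linarith)
  have hsp : 0 < √p := Real.sqrt_pos.2 (by linarith)
  set R0 := C * (ct * (max μ0 0 * (c2 * A0 / √p))) with hR0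
  have hR00 : 0 ≤ R0 := by positivity
  set V := ∫ x in Ω, Cp with hV
  have hV0 : 0 ≤ V := nn_int hΩ fun x _ => hCp0
  set D := 2 * R0 ^ χ + V with hD
  have hD0 : 0 ≤ D := by positivity
  obtain ⟨t', ht'⟩ : ∃ t', t' = k1 / (2 * χ) := ⟨_, rfl⟩
  have hkk : 1 / χ - (1 - 1 / k) = 1 / k1 := by rw [hiχ, hik1]; ring
  set E := max μ0 0 * (|C * (t' ^ 2 / (2 * t' - 1))| * max μ0 0 * D ^ (1 / k)) with hE
  have hE0 : 0 ≤ E := by positivity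
  set G := 1 + L * (E + 1) with hG
  have hG1 : 1 ≤ G := by
    have : 0 ≤ L * (E + 1) := by positivity
    linarith
  refine ⟨G ^ (1 / (1 - θ)), ?_⟩
  intro μ lam u v h hμ hl hst
  have hμm : μ ≤ max μ0 0 := by
    refine le_trans ?_ (le_max_left _ _)
    rw [← hl]; exact hμ0 lam u h.hu.continuous h.hun hst
  have hc := h.hu.continuous
  have hcU : Continuous fun x => 1 + u x := continuous_const.add hc
  have hg1 : ∀ x ∈ Ω, 0 ≤ - lap u x := fun x hx => by
    rw [h.hlu x hx]; exact mul_nonneg hμ.le (h.hvn x hx)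
  -- bound on J
  have hAu := hA μ lam u v h hμ hl hst
  have hJ := (est1 hΩ h hp hμ hl hst hs ht).2
  have hJ2 : ∫ x in Ω, u x ^ (2 * t - 1) * v x ≤ c2 * A0 / √p := by
    rw [le_div_iff₀ hsp]
    have := mul_le_mul_of_nonneg_left hAu hc20.le
    linarith
  have hJ0 : 0 ≤ ∫ x in Ω, u x ^ (2 * t - 1) * v x := nn_int hΩ fun x hx =>
    mul_nonneg (Real.rpow_nonneg (h.hun x hx) _) (h.hvn x hx)
  have S := sob_pow hΩ h.hu h.hu0 h.hun hg1 t (by linarith) hχ hC hS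
  have e1 : ∫ x in Ω, u x ^ (2 * t - 1) * (- lap u x) = μ * ∫ x in Ω, u x ^ (2 * t - 1) * v x := by
    rw [← integral_const_mul]
    refine setIntegral_congr_fun hΩ.1.measurableSet fun x hx => ?_
    show u x ^ (2 * t - 1) * (- lap u x) = _
    rw [h.hlu x hx]; ring
  rw [e1] at S
  have S2 : (∫ x in Ω, u x ^ r) ^ (1 / χ) ≤ R0 := by
    refine S.trans ?_
    rw [hR0]
    gcongr
  have hI0 : 0 ≤ ∫ x in Ω, u x ^ r := nn_int hΩ fun x hx => Real.rpow_nonneg (h.hun x hx) _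
  have S3 : ∫ x in Ω, u x ^ r ≤ R0 ^ χ := by
    have := Real.rpow_le_rpow (by positivity) S2 hχ.le
    rwa [← Real.rpow_mul hI0, one_div_mul_cancel hχ.ne', Real.rpow_one] at this
  have hUr : ∫ x in Ω, (1 + u x) ^ r ≤ D := by
    have i1 : IntegrableOn (fun x => 2 * u x ^ r) Ω :=
      intOn hΩ (continuous_const.mul (cont_pow hc hr0.le))
    have i2 : IntegrableOn (fun _ : EuclideanSpace ℝ (Fin n) => Cp) Ω := intOn hΩ continuous_const
    have : ∫ x in Ω, (1 + u x) ^ r ≤ 2 * (∫ x in Ω, u x ^ r) + V := by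
      rw [hV, ← integral_const_mul, ← integral_add i1 i2]
      refine setIntegral_mono_on (intOn hΩ (cont_pow hcU hr0.le)) (i1.add i2)
        hΩ.1.measurableSet fun x hx => ?_
      have := hCp _ (h.hun x hx)
      rw [Real.rpow_zero, one_mul, one_mul] at this
      show (1 + u x) ^ r ≤ 2 * u x ^ r + Cp
      linarith
    rw [hD]; linarith
  -- maximum
  obtain ⟨x0, hx0, hmax⟩ := hΩ.2.1.isCompact_closure.exists_isMaxOn
    hΩ.2.2.closure hc.continuousOn
  have hUM : ∀ x ∈ Ω, 1 + u x ≤ 1 + u x0 := fun x hx => by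
    have : u x ≤ u x0 := hmax (subset_closure hx)
    linarith
  have hM1 : 1 ≤ 1 + u x0 := by
    obtain ⟨y, hy⟩ := hΩ.2.2
    linarith [hUM y hy, h.hun y hy]
  set M := 1 + u x0 with hM
  have hM0 : 0 < M := by linarith
  have hUpk : (∫ x in Ω, (1 + u x) ^ (p * k)) ^ (1 / k) ≤ M ^ θ * D ^ (1 / k) := by
    have h1 : ∫ x in Ω, (1 + u x) ^ (p * k) ≤ M ^ (p * k - r') * D := by
      refine le_trans ?_ (mul_le_mul_of_nonneg_left hUr (by positivity))
      rw [← integral_const_mul]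
      refine setIntegral_mono_on (intOn hΩ (cont_pow hcU (by positivity)))
        (intOn hΩ (continuous_const.mul (cont_pow hcU hr0.le))) hΩ.1.measurableSet fun x hx => ?_
      have hU1 : 1 ≤ 1 + u x := by linarith [h.hun x hx]
      have hU : 0 < 1 + u x := by linarith
      calc (1 + u x) ^ (p * k) = (1 + u x) ^ (p * k - r') * (1 + u x) ^ r' := by
            rw [← Real.rpow_add hU]; congr 1; ring
        _ ≤ M ^ (p * k - r') * (1 + u x) ^ r := by
            refine mul_le_mul (Real.rpow_le_rpow hU.le (hUM x hx) (by linarith))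
              (Real.rpow_le_rpow_of_exponent_le hU1 hr'3) (by positivity) (by positivity)
    refine (Real.rpow_le_rpow (nn_int hΩ fun x hx => Real.rpow_nonneg
      (by linarith [h.hun x hx]) _) h1 (by positivity)).trans (le_of_eq ?_)
    rw [Real.mul_rpow (by positivity) hD0, ← Real.rpow_mul hM0.le, mul_one_div]
  have hE2 := lemE hΩ h hp hμ hχ hC hS hk hk1p hkk ht'
  have hMθ : 1 ≤ M ^ θ := Real.one_le_rpow hM1 hθ0
  have hst2 : ∀ x ∈ Ω, 1 + u x ≤ G * M ^ θ := by
    intro x hx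
    have h1 := hstamp u h.hu h.hu0 hg1 x hx
    have e2 : (∫ x in Ω, (- lap u x) ^ k1) ^ (1 / k1) = μ * (∫ x in Ω, v x ^ k1) ^ (1 / k1) := by
      have : ∫ x in Ω, (- lap u x) ^ k1 = μ ^ k1 * ∫ x in Ω, v x ^ k1 := by
        rw [← integral_const_mul]
        refine setIntegral_congr_fun hΩ.1.measurableSet fun x hx => ?_
        show (- lap u x) ^ k1 = _
        rw [h.hlu x hx, Real.mul_rpow hμ.le (h.hvn x hx)]
      rw [this, Real.mul_rpow (by positivity) (nn_int hΩ fun x hx =>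
        Real.rpow_nonneg (h.hvn x hx) _), ← Real.rpow_mul hμ.le, mul_one_div_cancel hk1p.ne',
        Real.rpow_one]
    rw [e2] at h1
    have h2 : μ * (∫ x in Ω, v x ^ k1) ^ (1 / k1) ≤ E * M ^ θ := by
      have hnn : 0 ≤ (∫ x in Ω, v x ^ k1) ^ (1 / k1) := Real.rpow_nonneg
        (nn_int hΩ fun x hx => Real.rpow_nonneg (h.hvn x hx) _) _
      have hnn2 : 0 ≤ (∫ x in Ω, (1 + u x) ^ (p * k)) ^ (1 / k) := Real.rpow_nonneg
        (nn_int hΩ fun x hx => Real.rpow_nonneg (by linarith [h.hun x hx]) _) _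
      calc μ * (∫ x in Ω, v x ^ k1) ^ (1 / k1)
          ≤ max μ0 0 * (|C * (t' ^ 2 / (2 * t' - 1))| * max μ0 0 * (M ^ θ * D ^ (1 / k))) := by
            refine mul_le_mul hμm (hE2.trans ?_) hnn (le_max_right _ _)
            refine mul_le_mul (mul_le_mul (le_abs_self _) hμm hμ.le (abs_nonneg _)) hUpk hnn2
              (by positivity)
        _ = E * M ^ θ := by rw [hE]; ring
    have h3 : u x ≤ L * (E * M ^ θ + M ^ θ) := h1.trans (by gcongr)
    calc 1 + u x ≤ M ^ θ + L * (E * M ^ θ + M ^ θ) := by linarith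
      _ = G * M ^ θ := by rw [hG]; ring
  have hMG : M ≤ G * M ^ θ := by
    by_cases hx0Ω : x0 ∈ Ω
    · exact hst2 x0 hx0Ω
    · have hf : x0 ∈ frontier Ω := ⟨hx0, by rwa [hΩ.1.interior_eq]⟩
      have : M = 1 := by rw [hM, h.hu0 x0 hf, add_zero]
      rw [this, Real.one_rpow]; linarith
  have hfin : M ≤ G ^ (1 / (1 - θ)) := by
    have h1 : M ^ (1 - θ) ≤ G := by
      rw [Real.rpow_sub hM0, Real.rpow_one, div_le_iff₀ (by positivity)]; exact hMG
    have := Real.rpow_le_rpow (by positivity) h1 (show 0 ≤ 1 / (1 - θ) from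
      div_nonneg zero_le_one (by linarith))
    rwa [← Real.rpow_mul hM0.le, mul_one_div_cancel (by linarith), Real.rpow_one] at this
  intro x hx
  linarith [hUM x hx]

end main2

/-- For `f(u) = (1+u)^p` with `p > 1`: a sequence of semistable solutions of `(N_{λ_m})`
satisfying the stability inequality is uniformly bounded in `L^∞(Ω)` whenever
`n < 4(p+1)/(p−1)·α* + 2`, where `α*` is the largest root of
`(p+1)²α⁴ − 8p(p+1)α² + 4p(p+3)α − 4p`. -/
theorem statement4 {n : ℕ} (Ω : Set (EuclideanSpace ℝ (Fin n))) (hΩ : GoodDomain Ω)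
    (p : ℝ) (hp : 1 < p)
    (lam : ℕ → ℝ) (hlam : ∀ m, 0 < lam m)
    (u : ℕ → EuclideanSpace ℝ (Fin n) → ℝ)
    (hsol : ∀ m, Solves Ω ⊤ (lam m) (fun t => (1 + t) ^ p) (u m))
    (hsemi : ∀ m, Semistable Ω (lam m) (fun t => (1 + t) ^ p) (u m))
    (hstab : ∀ m, StabIneq Ω (lam m) (fun t => (1 + t) ^ p) (u m))
    (αstar : ℝ)
    (hroot : (p + 1) ^ 2 * αstar ^ 4 - 8 * p * (p + 1) * αstar ^ 2
      + 4 * p * (p + 3) * αstar - 4 * p = 0)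
    (hmax : ∀ β : ℝ, (p + 1) ^ 2 * β ^ 4 - 8 * p * (p + 1) * β ^ 2
      + 4 * p * (p + 3) * β - 4 * p = 0 → β ≤ αstar)
    (hn : (n : ℝ) < 4 * (p + 1) / (p - 1) * αstar + 2) :
    ∃ C : ℝ, ∀ m, ∀ x ∈ Ω, u m x ≤ C := by
  rcases Nat.eq_zero_or_pos n with h0 | hn0
  · exfalso
    subst h0
    obtain ⟨x, hx⟩ := hΩ.2.2
    obtain ⟨-, h2, h3, -, -⟩ := hsol 0
    have h4 := h3 x hx
    have h5 : lap (lap (u 0)) x = 0 := by simp [lap]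
    have h6 : 0 < 1 + u 0 x := by linarith [(h2 x hx).1]
    have h7 := mul_pos (hlam 0) (Real.rpow_pos_of_pos h6 p)
    rw [h5] at h4
    exact absurd h4 h7.ne
  · set N : ℝ := max n 6 with hN
    obtain ⟨s, hs, hPs, hNs⟩ := choose_s (N := N) hp hroot hmax (by
      rcases le_total (n:ℝ) 6 with h | h
      · left; rw [hN, max_eq_right h]
      · right; rw [hN, max_eq_left h]; exact hn)
    have hN6 : 6 ≤ N := le_max_right _ _
    obtain ⟨C, hC, hS⟩ := sobolev hn0 hΩ N hN6 (le_max_left _ _)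
    have hS' : SobC Ω (N / (N - 2)) C := hS
    have hχ : 0 < N / (N - 2) := div_pos (by linarith) (by linarith)
    obtain ⟨M0, hM0⟩ := core hΩ hp hN6 hC hS' hs hPs hNs
    refine ⟨M0, fun m => ?_⟩
    obtain ⟨h1, h2, h3, h4, h5⟩ := hsol m
    have hμ : 0 < √(lam m) := Real.sqrt_pos.2 (hlam m)
    set c := - (1 / √(lam m)) with hc
    have hsm : ContDiff ℝ (⊤ : ℕ∞) (fun x => c * lap (u m) x) :=
      contDiff_const.mul (lap_smooth h1)
    have hlv : ∀ x ∈ Ω, - lap (fun x => c * lap (u m) x) x = √(lam m) * (1 + u m x) ^ p := by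
      intro x hx
      rw [lap_const_mul (lap_smooth h1), h3 x hx, hc]
      have : lam m = √(lam m) * √(lam m) := (Real.mul_self_sqrt (hlam m).le).symm
      field_simp
      rw [sq, ← this]
    have hv0 : ∀ x ∈ frontier Ω, c * lap (u m) x = 0 := fun x hx => by rw [h5 x hx, mul_zero]
    have hsys : Sys Ω p (√(lam m)) (u m) (fun x => c * lap (u m) x) :=
      { hu := h1
        hv := hsm
        hu0 := h4
        hv0 := hv0
        hun := fun x hx => (h2 x hx).1
        hvn := max_prin hΩ hsm hv0 (fun x hx => by
          rw [hlv x hx]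
          exact mul_nonneg hμ.le (Real.rpow_nonneg (by linarith [(h2 x hx).1]) _)) hχ hC hS'
        hlu := fun x hx => by
          rw [hc]; field_simp
        hlv := hlv }
    exact hM0 _ _ _ _ hsys hμ rfl (hstab m)

end
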